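/- arXiv:1310.2349 — 4 statements merged into one kernel-verified Lean document; each statement's English description precedes it below -/
import Mathlib

section
/- Suppose (X_n)_{n=1}^∞ is a sequence of jointly Gaussian random variables (every finite real linear combination of the X_n is Gaussian), each X_n being standard normal (mean 0, variance 1), and suppose there exists λ ∈ (0,1) such that |Cov(X_i, X_j)| ≤ λ^{|i−j|} for all i,j. Then lim_{n→∞} (max_{1≤j≤n} X_j)/√(2 log n) = 1 almost surely. -/
open MeasureTheory ProbabilityTheory Filter Set

section Gaussian

variable {Ω : Type*} [MeasurableSpace Ω] {P : Measure Ω}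

lemma integrable_exp_mul_of_map_eq_gaussianReal {Y : Ω → ℝ} {m : ℝ} {v : NNReal}
    (hY : AEMeasurable Y P) (hlaw : P.map Y = gaussianReal m v) (t : ℝ) :
    Integrable (fun ω => Real.exp (t * Y ω)) P := by
  have h := integrable_exp_mul_gaussianReal (μ := m) (v := v) t
  rw [← hlaw] at h
  exact h.comp_aemeasurable hY

lemma memLp_two_of_map_eq_gaussianReal {Y : Ω → ℝ} {m : ℝ} {v : NNReal}
    (hY : AEMeasurable Y P) (hlaw : P.map Y = gaussianReal m v) : MemLp Y 2 P := by
  have h := memLp_id_gaussianReal (μ := m) (v := v) 2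
  rw [← hlaw] at h
  exact (memLp_map_measure_iff (by fun_prop) hY).1 h

lemma integral_of_map_eq_gaussianReal {Y : Ω → ℝ} {m : ℝ} {v : NNReal}
    (hY : AEMeasurable Y P) (hlaw : P.map Y = gaussianReal m v) : ∫ ω, Y ω ∂P = m := by
  rw [HasLaw.integral_eq ⟨hY, hlaw⟩, integral_id_gaussianReal]

lemma variance_of_map_eq_gaussianReal {Y : Ω → ℝ} {m : ℝ} {v : NNReal}
    (hY : AEMeasurable Y P) (hlaw : P.map Y = gaussianReal m v) : Var[Y; P] = v := by
  rw [HasLaw.variance_eq ⟨hY, hlaw⟩, variance_id_gaussianReal]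

lemma integral_exp_affine_of_map_eq_std {Y : Ω → ℝ}
    (hlaw : P.map Y = gaussianReal 0 1) (t d : ℝ) :
    ∫ ω, Real.exp (t * Y ω + d) ∂P = Real.exp (t ^ 2 / 2 + d) := by
  have h := mgf_gaussianReal hlaw t
  rw [mgf] at h
  simp only [Real.exp_add, integral_mul_const, h]
  simp

lemma integrable_exp_affine_of_map_eq_std {Y : Ω → ℝ} (hY : AEMeasurable Y P)
    (hlaw : P.map Y = gaussianReal 0 1) (t d : ℝ) :
    Integrable (fun ω => Real.exp (t * Y ω + d)) P := by
  simp only [Real.exp_add]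
  exact (integrable_exp_mul_of_map_eq_gaussianReal hY hlaw t).mul_const _

/-- Chernoff bound for a standard normal variable. -/
lemma measureReal_ge_le_exp_neg_sq_div_two [IsProbabilityMeasure P] {Y : Ω → ℝ}
    (hY : AEMeasurable Y P) (hlaw : P.map Y = gaussianReal 0 1) {x : ℝ} (hx : 0 ≤ x) :
    P.real {ω | x ≤ Y ω} ≤ Real.exp (-(x ^ 2 / 2)) := by
  refine (measure_ge_le_exp_mul_mgf x hx
    (integrable_exp_mul_of_map_eq_gaussianReal hY hlaw x)).trans_eq ?_
  rw [mgf_gaussianReal hlaw, ← Real.exp_add]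
  congr 1
  push_cast
  ring

/-- The exponential moment of the sum of two jointly Gaussian standard normal variables. -/
lemma integral_exp_mul_add_eq_of_std [IsProbabilityMeasure P] {Y Z : Ω → ℝ}
    (hY : AEMeasurable Y P) (hZ : AEMeasurable Z P)
    (hYlaw : P.map Y = gaussianReal 0 1) (hZlaw : P.map Z = gaussianReal 0 1)
    (hsum : ∃ m : ℝ, ∃ v : NNReal, P.map (Y + Z) = gaussianReal m v) (t : ℝ) :
    ∫ ω, Real.exp (t * (Y + Z) ω) ∂P = Real.exp (t ^ 2 * (1 + ∫ ω, Y ω * Z ω ∂P)) := by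
  obtain ⟨m, v, hmv⟩ := hsum
  have hY2 := memLp_two_of_map_eq_gaussianReal hY hYlaw
  have hZ2 := memLp_two_of_map_eq_gaussianReal hZ hZlaw
  have hYm := integral_of_map_eq_gaussianReal hY hYlaw
  have hZm := integral_of_map_eq_gaussianReal hZ hZlaw
  have hm : m = 0 := by
    rw [← integral_of_map_eq_gaussianReal (hY.add hZ) hmv]
    simp only [Pi.add_apply]
    rw [integral_add (hY2.integrable one_le_two) (hZ2.integrable one_le_two), hYm, hZm, add_zero]
  have hv : (v : ℝ) = 2 + 2 * ∫ ω, Y ω * Z ω ∂P := by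
    rw [← variance_of_map_eq_gaussianReal (hY.add hZ) hmv, variance_add hY2 hZ2,
      variance_of_map_eq_gaussianReal hY hYlaw, variance_of_map_eq_gaussianReal hZ hZlaw,
      covariance_eq_sub hY2 hZ2, hYm, hZm]
    simp only [Pi.mul_apply]
    push_cast
    ring
  have h := mgf_gaussianReal hmv t
  rw [mgf] at h
  rw [h, hm, hv]
  congr 1
  ring

end Gaussian

/-- The exponential weight `exp (t * x - t ^ 2 / 2)` truncated to the window `(t - s, t + s]`. -/
noncomputable def truncExp (t s : ℝ) : ℝ → ℝ :=
  indicator (Ioc (t - s) (t + s)) fun x => Real.exp (t * x + -(t ^ 2 / 2))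

section TruncExp

variable {t s : ℝ}

lemma truncExp_nonneg (x : ℝ) : 0 ≤ truncExp t s x :=
  indicator_nonneg (fun _ _ => (Real.exp_pos _).le) x

lemma truncExp_le_exp (x : ℝ) : truncExp t s x ≤ Real.exp (t * x + -(t ^ 2 / 2)) :=
  indicator_le_self' (fun _ _ => (Real.exp_pos _).le) x

lemma truncExp_le_const (ht : 0 ≤ t) (x : ℝ) :
    truncExp t s x ≤ Real.exp (t * (t + s) + -(t ^ 2 / 2)) := by
  refine indicator_le' (fun y hy => ?_) (fun _ _ => (Real.exp_pos _).le) x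
  have := hy.2
  gcongr

lemma truncExp_eq_zero {x : ℝ} (hx : x ≤ t - s) : truncExp t s x = 0 :=
  indicator_of_notMem (fun h => absurd h.1 (not_lt.2 hx)) _

lemma measurable_truncExp : Measurable (truncExp t s) :=
  Measurable.indicator (by fun_prop) measurableSet_Ioc

lemma le_truncExp (hs : 0 ≤ s) (x : ℝ) :
    Real.exp (t * x + -(t ^ 2 / 2)) - Real.exp ((t + s) * x + (-(s * (t + s)) - t ^ 2 / 2))
      - Real.exp ((t - s) * x + (s * (t - s) - t ^ 2 / 2)) ≤ truncExp t s x := by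
  by_cases hx : x ∈ Ioc (t - s) (t + s)
  · rw [truncExp, indicator_of_mem hx]
    linarith [Real.exp_pos ((t + s) * x + (-(s * (t + s)) - t ^ 2 / 2)),
      Real.exp_pos ((t - s) * x + (s * (t - s) - t ^ 2 / 2))]
  · rw [truncExp, indicator_of_notMem hx]
    by_cases h1 : x ≤ t - s
    · have : Real.exp (t * x + -(t ^ 2 / 2))
          ≤ Real.exp ((t - s) * x + (s * (t - s) - t ^ 2 / 2)) := by
        apply Real.exp_le_exp.2
        nlinarith [mul_nonneg hs (sub_nonneg.2 h1)]
      linarith [Real.exp_pos ((t + s) * x + (-(s * (t + s)) - t ^ 2 / 2))]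
    · have h2 : t + s ≤ x := by
        by_contra! h
        exact hx ⟨not_le.1 h1, h.le⟩
      have : Real.exp (t * x + -(t ^ 2 / 2))
          ≤ Real.exp ((t + s) * x + (-(s * (t + s)) - t ^ 2 / 2)) := by
        apply Real.exp_le_exp.2
        nlinarith [mul_nonneg hs (sub_nonneg.2 h2)]
      linarith [Real.exp_pos ((t - s) * x + (s * (t - s) - t ^ 2 / 2))]

variable {Ω : Type*} [MeasurableSpace Ω] {P : Measure Ω} [IsProbabilityMeasure P]

lemma memLp_truncExp_comp (ht : 0 ≤ t) {Y : Ω → ℝ} (hY : AEMeasurable Y P) (p : ENNReal) :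
    MemLp (fun ω => truncExp t s (Y ω)) p P :=
  memLp_of_bounded (ae_of_all _ fun _ => ⟨truncExp_nonneg _, truncExp_le_const ht _⟩)
    (measurable_truncExp.comp_aemeasurable hY).aestronglyMeasurable p

lemma integral_truncExp_le_one (ht : 0 ≤ t) {Y : Ω → ℝ} (hY : AEMeasurable Y P)
    (hlaw : P.map Y = gaussianReal 0 1) : ∫ ω, truncExp t s (Y ω) ∂P ≤ 1 := by
  refine (integral_mono ((memLp_truncExp_comp ht hY 1).integrable le_rfl)
    (integrable_exp_affine_of_map_eq_std hY hlaw t _)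
    fun ω => truncExp_le_exp (Y ω)).trans_eq ?_
  rw [integral_exp_affine_of_map_eq_std hlaw]
  simp

lemma one_sub_le_integral_truncExp (ht : 0 ≤ t) (hs : 0 ≤ s) {Y : Ω → ℝ} (hY : AEMeasurable Y P)
    (hlaw : P.map Y = gaussianReal 0 1) :
    1 - 2 * Real.exp (-(s ^ 2 / 2)) ≤ ∫ ω, truncExp t s (Y ω) ∂P := by
  have hint := integrable_exp_affine_of_map_eq_std hY hlaw
  have hdiff : Integrable (fun ω => Real.exp (t * Y ω + -(t ^ 2 / 2))
      - Real.exp ((t + s) * Y ω + (-(s * (t + s)) - t ^ 2 / 2))) P := (hint t _).sub (hint (t + s) _)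
  refine le_trans (le_of_eq ?_) (integral_mono (hdiff.sub (hint (t - s) _))
    ((memLp_truncExp_comp ht hY 1).integrable le_rfl) fun ω => le_truncExp hs (Y ω))
  simp only [Pi.sub_apply]
  rw [integral_sub hdiff (hint (t - s) _), integral_sub (hint t _) (hint (t + s) _)]
  simp only [integral_exp_affine_of_map_eq_std hlaw]
  rw [show t ^ 2 / 2 + -(t ^ 2 / 2) = 0 by ring,
    show (t + s) ^ 2 / 2 + (-(s * (t + s)) - t ^ 2 / 2) = -(s ^ 2 / 2) by ring,
    show (t - s) ^ 2 / 2 + (s * (t - s) - t ^ 2 / 2) = -(s ^ 2 / 2) by ring, Real.exp_zero]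
  ring

lemma integral_truncExp_mul_le_const (ht : 0 ≤ t) {Y Z : Ω → ℝ} (hY : AEMeasurable Y P)
    (hZ : AEMeasurable Z P) (hlaw : P.map Y = gaussianReal 0 1) :
    ∫ ω, truncExp t s (Y ω) * truncExp t s (Z ω) ∂P
      ≤ Real.exp (t * (t + s) + -(t ^ 2 / 2)) := by
  have hY1 := (memLp_truncExp_comp (s := s) ht hY 1).integrable le_rfl
  calc _ ≤ ∫ ω, truncExp t s (Y ω) * Real.exp (t * (t + s) + -(t ^ 2 / 2)) ∂P :=
        integral_mono
          ((memLp_truncExp_comp ht hY 2).integrable_mul (memLp_truncExp_comp ht hZ 2))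
          (hY1.mul_const _)
          fun ω => mul_le_mul_of_nonneg_left (truncExp_le_const ht _) (truncExp_nonneg _)
    _ ≤ _ := by
        rw [integral_mul_const]
        exact mul_le_of_le_one_left (Real.exp_pos _).le (integral_truncExp_le_one ht hY hlaw)

lemma integral_truncExp_mul_le_exp (ht : 0 ≤ t) {Y Z : Ω → ℝ} (hY : AEMeasurable Y P)
    (hZ : AEMeasurable Z P) (hYlaw : P.map Y = gaussianReal 0 1)
    (hZlaw : P.map Z = gaussianReal 0 1)
    (hsum : ∃ m : ℝ, ∃ v : NNReal, P.map (Y + Z) = gaussianReal m v) :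
    ∫ ω, truncExp t s (Y ω) * truncExp t s (Z ω) ∂P
      ≤ Real.exp (t ^ 2 * ∫ ω, Y ω * Z ω ∂P) := by
  obtain ⟨m, v, hmv⟩ := hsum
  have hint := integrable_exp_mul_of_map_eq_gaussianReal (hY.add hZ) hmv t
  calc _ ≤ ∫ ω, Real.exp (t * (Y + Z) ω) * Real.exp (-t ^ 2) ∂P := by
        refine integral_mono
          ((memLp_truncExp_comp ht hY 2).integrable_mul (memLp_truncExp_comp ht hZ 2))
          (hint.mul_const _) fun ω => ?_
        refine (mul_le_mul (truncExp_le_exp _) (truncExp_le_exp _) (truncExp_nonneg _)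
          (Real.exp_pos _).le).trans_eq ?_
        simp only [Pi.add_apply, ← Real.exp_add]
        congr 1
        ring
    _ = _ := by
        rw [integral_mul_const, integral_exp_mul_add_eq_of_std hY hZ hYlaw hZlaw ⟨m, v, hmv⟩,
          ← Real.exp_add]
        congr 1
        ring

end TruncExp

/-- A second moment bound for the probability that finitely many variables vanish together. -/
lemma measureReal_forall_eq_zero_le {Ω ι : Type*} [MeasurableSpace Ω] {P : Measure Ω}
    [IsProbabilityMeasure P] {S : Finset ι} (hS : S.Nonempty) {g : ι → Ω → ℝ}
    (hg : ∀ i, MemLp (g i) 2 P) {δ κ : ℝ} (hmean : ∀ i ∈ S, 1 - δ ≤ ∫ ω, g i ω ∂P)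
    (hsq : ∑ i ∈ S, ∑ j ∈ S, ∫ ω, g i ω * g j ω ∂P ≤ (S.card : ℝ) ^ 2 * (1 + κ)) :
    P.real {ω | ∀ i ∈ S, g i ω = 0} ≤ κ + 2 * δ := by
  set N : ℝ := (S.card : ℝ) with hN
  have hNpos : 0 < N := by simpa [hN] using hS
  set W : Ω → ℝ := fun ω => (∑ i ∈ S, g i ω) with hW
  have hWmem : MemLp W 2 P := memLp_finsetSum S fun i _ => hg i
  have hWint : Integrable W P := hWmem.integrable one_le_two
  have hWsq : Integrable (fun ω => W ω ^ 2) P := hWmem.integrable_sq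
  have hW1 : N * (1 - δ) ≤ ∫ ω, W ω ∂P := by
    rw [hW, integral_finsetSum S fun i _ => (hg i).integrable one_le_two, hN, ← nsmul_eq_mul]
    exact Finset.card_nsmul_le_sum _ _ _ hmean
  have hprod : ∀ i j, Integrable (fun ω => g i ω * g j ω) P := fun i j =>
    (hg i).integrable_mul (hg j)
  have hW2 : ∫ ω, W ω ^ 2 ∂P ≤ N ^ 2 * (1 + κ) := by
    refine le_trans (le_of_eq ?_) hsq
    simp only [hW, sq, Finset.sum_mul_sum]
    rw [integral_finsetSum S fun i _ => integrable_finsetSum S fun j _ => hprod i j]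
    exact Finset.sum_congr rfl fun i _ => integral_finsetSum S fun j _ => hprod i j
  have hexp : ∀ ω, (W ω - N) ^ 2 = W ω ^ 2 - 2 * N * W ω + N ^ 2 := fun ω => by ring
  have hcenter : Integrable (fun ω => (W ω - N) ^ 2) P := by
    simp only [hexp]
    exact (hWsq.sub (hWint.const_mul _)).add (integrable_const _)
  have hcheb := mul_meas_ge_le_integral_of_nonneg
    (ae_of_all P fun ω => sq_nonneg (W ω - N)) hcenter (N ^ 2)
  have hval : ∫ ω, (W ω - N) ^ 2 ∂P = ∫ ω, W ω ^ 2 ∂P - 2 * N * ∫ ω, W ω ∂P + N ^ 2 := by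
    simp only [hexp]
    have hsub : Integrable (fun ω => W ω ^ 2 - 2 * N * W ω) P := hWsq.sub (hWint.const_mul _)
    rw [integral_add hsub (integrable_const _), integral_sub hWsq (hWint.const_mul _), integral_const_mul]
    simp
  have hsub : P.real {ω | ∀ i ∈ S, g i ω = 0} ≤ P.real {ω | N ^ 2 ≤ (W ω - N) ^ 2} := by
    refine measureReal_mono fun ω hω => ?_
    have : W ω = 0 := Finset.sum_eq_zero hω
    simp [this]
  have hmain : N ^ 2 * P.real {ω | ∀ i ∈ S, g i ω = 0} ≤ N ^ 2 * (κ + 2 * δ) := by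
    calc _ ≤ N ^ 2 * P.real {ω | N ^ 2 ≤ (W ω - N) ^ 2} := by gcongr
      _ ≤ _ := by nlinarith [mul_le_mul_of_nonneg_left hW1 hNpos.le]
  exact le_of_mul_le_mul_left hmain (by positivity)

lemma card_filter_natAbs_sub_lt_le (S : Finset ℕ) (i m : ℕ) :
    (S.filter fun j : ℕ => ((i : ℤ) - (j : ℤ)).natAbs < m).card ≤ 2 * m := by
  calc _ ≤ (Finset.Ico (i + 1 - m) (i + m)).card := by
        refine Finset.card_le_card fun j hj => ?_
        rw [Finset.mem_filter] at hj
        rw [Finset.mem_Ico]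
        omega
    _ ≤ 2 * m := by
        rw [Nat.card_Ico]
        omega

section Sequence

variable {Ω : Type*} [MeasurableSpace Ω] {P : Measure Ω} [IsProbabilityMeasure P] {X : ℕ → Ω → ℝ}

lemma measureReal_forall_le_of_decay (hmeas : ∀ n, Measurable (X n))
    (hpair : ∀ i j, i ≠ j → ∃ m : ℝ, ∃ v : NNReal, P.map (X i + X j) = gaussianReal m v)
    (hstd : ∀ n, P.map (X n) = gaussianReal 0 1) {lam : ℝ} (hlam : lam ∈ Ioo (0 : ℝ) 1)
    (hcov : ∀ i j : ℕ, |∫ ω, X i ω * X j ω ∂P| ≤ lam ^ ((i : ℤ) - (j : ℤ)).natAbs)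
    {n m : ℕ} (hn : 0 < n) (hm : 0 < m) {t s : ℝ} (ht : 0 ≤ t) (hs : 0 ≤ s) :
    P.real {ω | ∀ i ∈ Finset.Icc 1 n, X i ω ≤ t - s}
      ≤ (Real.exp (t ^ 2 * lam ^ m) - 1) + 2 * m * Real.exp (t * (t + s) + -(t ^ 2 / 2)) / n
        + 4 * Real.exp (-(s ^ 2 / 2)) := by
  set A := Real.exp (t ^ 2 * lam ^ m) with hA
  set B := Real.exp (t * (t + s) + -(t ^ 2 / 2)) with hB
  have hpos : (0 : ℝ) < n := by exact_mod_cast hn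
  have hcorr : ∀ i j, ∫ ω, truncExp t s (X i ω) * truncExp t s (X j ω) ∂P
      ≤ A + if ((i : ℤ) - (j : ℤ)).natAbs < m then B else 0 := by
    intro i j
    split_ifs with h
    · linarith [integral_truncExp_mul_le_const (s := s) ht (hmeas i).aemeasurable
        (hmeas j).aemeasurable (hstd i), Real.exp_pos (t ^ 2 * lam ^ m)]
    · have hij : i ≠ j := by
        rintro rfl
        simp [hm] at h
      rw [add_zero]
      refine (integral_truncExp_mul_le_exp ht (hmeas i).aemeasurable (hmeas j).aemeasurable
        (hstd i) (hstd j) (hpair i j hij)).trans (Real.exp_le_exp.2 ?_)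
      refine mul_le_mul_of_nonneg_left ?_ (sq_nonneg t)
      exact (le_abs_self _).trans ((hcov i j).trans
        (pow_le_pow_of_le_one hlam.1.le hlam.2.le (not_lt.1 h)))
  have hsq : ∑ i ∈ Finset.Icc 1 n, ∑ j ∈ Finset.Icc 1 n,
      ∫ ω, truncExp t s (X i ω) * truncExp t s (X j ω) ∂P
      ≤ ((Finset.Icc 1 n).card : ℝ) ^ 2 * (1 + ((A - 1) + 2 * m * B / n)) := by
    have hrow : ∀ i ∈ Finset.Icc 1 n, ∑ j ∈ Finset.Icc 1 n,
        ∫ ω, truncExp t s (X i ω) * truncExp t s (X j ω) ∂P ≤ n * A + 2 * m * B := by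
      intro i _
      refine (Finset.sum_le_sum fun j _ => hcorr i j).trans ?_
      rw [Finset.sum_add_distrib, ← Finset.sum_filter, Finset.sum_const, Finset.sum_const,
        nsmul_eq_mul, nsmul_eq_mul, Nat.card_Icc, Nat.add_sub_cancel]
      have : (((Finset.Icc 1 n).filter fun j : ℕ => ((i : ℤ) - (j : ℤ)).natAbs < m).card : ℝ)
          ≤ 2 * m := by exact_mod_cast card_filter_natAbs_sub_lt_le _ i m
      have hB0 : 0 ≤ B := (Real.exp_pos _).le
      gcongr
    refine (Finset.sum_le_card_nsmul _ _ _ hrow).trans_eq ?_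
    rw [Nat.card_Icc, Nat.add_sub_cancel, nsmul_eq_mul]
    field_simp
    ring
  have hbound := measureReal_forall_eq_zero_le (P := P) (S := Finset.Icc 1 n)
    (g := fun i ω => truncExp t s (X i ω)) (Finset.nonempty_Icc.2 hn)
    (fun i => memLp_truncExp_comp ht (hmeas i).aemeasurable 2)
    (fun i _ => one_sub_le_integral_truncExp ht hs (hmeas i).aemeasurable (hstd i)) hsq
  have hsub : {ω | ∀ i ∈ Finset.Icc 1 n, X i ω ≤ t - s}
      ⊆ {ω | ∀ i ∈ Finset.Icc 1 n, truncExp t s (X i ω) = 0} :=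
    fun ω hω i hi => truncExp_eq_zero (hω i hi)
  refine (measureReal_mono hsub).trans (hbound.trans_eq ?_)
  ring

lemma summable_exp_sub_one_of_summable {u : ℕ → ℝ} (hu : Summable u) :
    Summable fun k => Real.exp (u k) - 1 := by
  refine Summable.of_norm_bounded_eventually_nat (hu.abs.mul_left 2) ?_
  have h : Tendsto (fun k => |u k|) atTop (nhds 0) := hu.abs.tendsto_atTop_zero
  filter_upwards [h.eventually_le_const zero_lt_one] with k hk
  exact Real.abs_exp_sub_one_le hk

lemma ae_eventually_exists_dyadic_lt (hmeas : ∀ n, Measurable (X n))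
    (hpair : ∀ i j, i ≠ j → ∃ m : ℝ, ∃ v : NNReal, P.map (X i + X j) = gaussianReal m v)
    (hstd : ∀ n, P.map (X n) = gaussianReal 0 1) {lam : ℝ} (hlam : lam ∈ Ioo (0 : ℝ) 1)
    (hcov : ∀ i j : ℕ, |∫ ω, X i ω * X j ω ∂P| ≤ lam ^ ((i : ℤ) - (j : ℤ)).natAbs)
    {d : ℝ} (hd : d ∈ Ioo (0 : ℝ) 1) :
    ∀ᵐ ω ∂P, ∀ᶠ k : ℕ in atTop,
      ∃ i ∈ Finset.Icc 1 (2 ^ k), d * √(2 * (k * Real.log 2)) < X i ω := by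
  set η : ℝ := ((1 - d) / 2) ^ 2 with hη
  set r : ℝ := Real.exp (-(η * Real.log 2)) with hr
  have hη0 : 0 < η := by
    have := hd.2
    have : 0 < (1 - d) / 2 := by linarith
    positivity
  have hlog2 : 0 < Real.log 2 := Real.log_pos one_lt_two
  have hr1 : ‖r‖ < 1 := by
    rw [Real.norm_of_nonneg (Real.exp_pos _).le, Real.exp_lt_one_iff]
    nlinarith
  have hrpow : ∀ k : ℕ, r ^ k = Real.exp (-(η * (k * Real.log 2))) := fun k => by
    rw [hr, ← Real.exp_nat_mul]
    congr 1
    ring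
  have hl1 : ‖lam‖ < 1 := by
    rw [Real.norm_of_nonneg hlam.1.le]
    exact hlam.2
  have hsummable : Summable fun k : ℕ =>
      (Real.exp (2 * ((1 + d) / 2) ^ 2 * Real.log 2 * ((k : ℝ) ^ 1 * lam ^ k)) - 1)
        + 2 * ((k : ℝ) ^ 1 * r ^ k) + 4 * r ^ k :=
    ((summable_exp_sub_one_of_summable
      ((summable_pow_mul_geometric_of_norm_lt_one 1 hl1).mul_left _)).add
      ((summable_pow_mul_geometric_of_norm_lt_one 1 hr1).mul_left 2)).add
      ((summable_geometric_of_norm_lt_one hr1).mul_left 4)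
  have hprob : ∀ᶠ k : ℕ in atTop,
      ‖P.real {ω | ∀ i ∈ Finset.Icc 1 (2 ^ k), X i ω ≤ d * √(2 * (k * Real.log 2))}‖
        ≤ (Real.exp (2 * ((1 + d) / 2) ^ 2 * Real.log 2 * ((k : ℝ) ^ 1 * lam ^ k)) - 1)
        + 2 * ((k : ℝ) ^ 1 * r ^ k) + 4 * r ^ k := by
    filter_upwards [eventually_gt_atTop 0] with k hk
    rw [Real.norm_of_nonneg measureReal_nonneg]
    set b : ℝ := √(2 * (k * Real.log 2)) with hb
    have hb0 : 0 ≤ b := Real.sqrt_nonneg _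
    have hbsq : b ^ 2 = 2 * (k * Real.log 2) := Real.sq_sqrt (by positivity)
    have h := measureReal_forall_le_of_decay hmeas hpair hstd hlam hcov (n := 2 ^ k)
      (by positivity) hk (t := (1 + d) / 2 * b) (s := (1 - d) / 2 * b)
      (mul_nonneg (by linarith [hd.1]) hb0) (mul_nonneg (by linarith [hd.2]) hb0)
    have h2k : ((2 ^ k : ℕ) : ℝ) = Real.exp (k * Real.log 2) := by
      rw [Real.exp_nat_mul, Real.exp_log two_pos]
      norm_num
    rw [h2k, mul_div_assoc, ← Real.exp_sub] at h
    have e1 : (1 + d) / 2 * b - (1 - d) / 2 * b = d * b := by ring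
    have e2 : ((1 + d) / 2 * b) ^ 2 * lam ^ k
        = 2 * ((1 + d) / 2) ^ 2 * Real.log 2 * ((k : ℝ) ^ 1 * lam ^ k) := by
      rw [mul_pow, hbsq]
      ring
    have e3 : (1 + d) / 2 * b * ((1 + d) / 2 * b + (1 - d) / 2 * b)
        + -(((1 + d) / 2 * b) ^ 2 / 2) - k * Real.log 2 = -(η * (k * Real.log 2)) := by
      rw [hη]
      linear_combination ((1 + d) / 2 - ((1 + d) / 2) ^ 2 / 2) * hbsq
    have e4 : -(((1 - d) / 2 * b) ^ 2 / 2) = -(η * (k * Real.log 2)) := by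
      rw [hη, mul_pow, hbsq]
      ring
    rw [e1, e2, e3, e4, ← hrpow] at h
    refine h.trans_eq ?_
    ring
  have hBC := (Summable.of_norm_bounded_eventually_nat hsummable hprob).tsum_ofReal_ne_top
  simp only [Measure.real, ENNReal.ofReal_toReal (measure_ne_top P _)] at hBC
  filter_upwards [ae_eventually_notMem hBC] with ω hω
  filter_upwards [hω] with k hk
  simpa [and_assoc] using hk

lemma ae_eventually_lt_mul_sqrt_log (hmeas : ∀ n, Measurable (X n))
    (hstd : ∀ n, P.map (X n) = gaussianReal 0 1) {c : ℝ} (hc : 1 < c) :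
    ∀ᵐ ω ∂P, ∀ᶠ n : ℕ in atTop, X n ω < c * √(2 * Real.log n) := by
  have hsummable : Summable fun n : ℕ => (n : ℝ) ^ (-c ^ 2) :=
    Real.summable_nat_rpow.2 (by nlinarith)
  have hprob : ∀ᶠ n : ℕ in atTop,
      ‖P.real {ω | c * √(2 * Real.log n) ≤ X n ω}‖ ≤ (n : ℝ) ^ (-c ^ 2) := by
    filter_upwards [eventually_gt_atTop 0] with n hn
    have hn0 : (0 : ℝ) < n := by exact_mod_cast hn
    rw [Real.norm_of_nonneg measureReal_nonneg]
    refine (measureReal_ge_le_exp_neg_sq_div_two (hmeas n).aemeasurable (hstd n)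
      (by positivity)).trans_eq ?_
    rw [mul_pow, Real.sq_sqrt (mul_nonneg two_pos.le (Real.log_natCast_nonneg n)),
      Real.rpow_def_of_pos hn0]
    congr 1
    ring
  have hBC := (Summable.of_norm_bounded_eventually_nat hsummable hprob).tsum_ofReal_ne_top
  simp only [Measure.real, ENNReal.ofReal_toReal (measure_ne_top P _)] at hBC
  filter_upwards [ae_eventually_notMem hBC] with ω hω
  filter_upwards [hω] with n hn
  simpa using hn

end Sequence

section Deterministic

variable {x : ℕ → ℝ}

lemma tendsto_sqrt_two_mul_log_atTop :
    Tendsto (fun n : ℕ => √(2 * Real.log n)) atTop atTop :=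
  Real.tendsto_sqrt_atTop.comp
    ((Real.tendsto_log_atTop.comp tendsto_natCast_atTop_atTop).const_mul_atTop two_pos)

lemma eventually_iSup_Icc_div_lt {c c' : ℝ} (hc : 0 < c) (hcc' : c < c')
    (h : ∀ᶠ n : ℕ in atTop, x n < c * √(2 * Real.log n)) :
    ∀ᶠ n : ℕ in atTop, (⨆ j : (Icc 1 n : Set ℕ), x j) / √(2 * Real.log n) < c' := by
  obtain ⟨N, hN⟩ := eventually_atTop.1 h
  filter_upwards [eventually_ge_atTop 1, tendsto_sqrt_two_mul_log_atTop.eventually_gt_atTop 0,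
    tendsto_sqrt_two_mul_log_atTop.eventually_ge_atTop ((∑ i ∈ Finset.range N, |x i|) / c)]
    with n hn1 hpos hbig
  rw [div_le_iff₀' hc] at hbig
  rw [div_lt_iff₀ hpos]
  have : Nonempty (Icc 1 n : Set ℕ) := ⟨⟨1, le_rfl, hn1⟩⟩
  refine (ciSup_le fun j => ?_).trans_lt (mul_lt_mul_of_pos_right hcc' hpos)
  obtain ⟨j, hj1, hjn⟩ := j
  rcases lt_or_ge j N with hj | hj
  · exact (le_abs_self _).trans ((Finset.single_le_sum (f := fun i => |x i|)
      (fun _ _ => abs_nonneg _) (Finset.mem_range.2 hj)).trans hbig)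
  · refine (hN j hj).le.trans ?_
    have : (0 : ℝ) < j := by exact_mod_cast hj1
    gcongr

lemma eventually_lt_iSup_Icc_div {d d' : ℝ} (hd' : 0 < d') (hdd' : d' < d)
    (h : ∀ᶠ k : ℕ in atTop, ∃ i ∈ Finset.Icc 1 (2 ^ k), d * √(2 * (k * Real.log 2)) < x i) :
    ∀ᶠ n : ℕ in atTop, d' < (⨆ j : (Icc 1 n : Set ℕ), x j) / √(2 * Real.log n) := by
  have hlog : Tendsto (fun n => Nat.log 2 n) atTop atTop :=
    tendsto_atTop.2 fun b => by
      filter_upwards [eventually_ge_atTop (2 ^ b)] with n hn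
      exact Nat.le_log_of_pow_le one_lt_two hn
  have hsq : 0 < d ^ 2 - d' ^ 2 := by nlinarith
  have hratio : ∀ᶠ k : ℕ in atTop, d' ^ 2 / (d ^ 2 - d' ^ 2) ≤ (k : ℝ) :=
    tendsto_natCast_atTop_atTop.eventually_ge_atTop _
  filter_upwards [hlog.eventually h, hlog.eventually hratio, eventually_ge_atTop 1,
    tendsto_sqrt_two_mul_log_atTop.eventually_gt_atTop 0] with n hex hk hn hpos
  obtain ⟨i, hi, hxi⟩ := hex
  rw [Finset.mem_Icc] at hi
  set k := Nat.log 2 n with hkdef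
  have hin : i ∈ (Icc 1 n : Set ℕ) := ⟨hi.1, hi.2.trans (Nat.pow_log_le_self 2 (by omega))⟩
  have hle : x i ≤ ⨆ j : (Icc 1 n : Set ℕ), x j :=
    le_ciSup (f := fun j : (Icc 1 n : Set ℕ) => x j) (Set.finite_range _).bddAbove ⟨i, hin⟩
  have hlogn : Real.log n ≤ (k + 1) * Real.log 2 := by
    have h1 : (n : ℝ) ≤ 2 ^ (k + 1) := by
      exact_mod_cast (Nat.lt_pow_succ_log_self one_lt_two n).le
    refine (Real.log_le_log (by exact_mod_cast hn) h1).trans_eq ?_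
    rw [Real.log_pow]
    push_cast
    ring
  rw [lt_div_iff₀ hpos]
  refine lt_of_le_of_lt ?_ (hxi.trans_le hle)
  rw [div_le_iff₀ hsq] at hk
  have hlog2 : 0 < Real.log 2 := Real.log_pos one_lt_two
  have hsqrt : ∀ {a y : ℝ}, 0 < a → a * √y = √(a ^ 2 * y) := fun {a y} ha => by
    rw [Real.sqrt_mul (sq_nonneg a), Real.sqrt_sq ha.le]
  rw [hsqrt hd', hsqrt (hd'.trans hdd')]
  apply Real.sqrt_le_sqrt
  calc d' ^ 2 * (2 * Real.log n) ≤ d' ^ 2 * (2 * ((k + 1) * Real.log 2)) := by gcongr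
    _ = (d' ^ 2 * (k + 1)) * (2 * Real.log 2) := by ring
    _ ≤ (d ^ 2 * k) * (2 * Real.log 2) := by
        refine mul_le_mul_of_nonneg_right ?_ (by positivity)
        linarith
    _ = d ^ 2 * (2 * (k * Real.log 2)) := by ring

end Deterministic

/-- If `(X n)_{n ≥ 1}` is a sequence of jointly Gaussian standard normal
random variables with `|Cov(X i, X j)| ≤ λ^{|i-j|}` for some `λ ∈ (0,1)`, then
`max_{1 ≤ j ≤ n} X j / √(2 log n) → 1` almost surely. -/
theorem stmt5
    {Ω : Type*} [MeasurableSpace Ω] (P : Measure Ω) [IsProbabilityMeasure P]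
    (X : ℕ → Ω → ℝ)
    (hmeas : ∀ n, Measurable (X n))
    -- jointly Gaussian: every finite real linear combination is Gaussian
    (hjoint : ∀ (s : Finset ℕ) (c : ℕ → ℝ), ∃ m : ℝ, ∃ v : NNReal,
      P.map (fun ω => ∑ j ∈ s, c j * X j ω) = gaussianReal m v)
    -- each X n is standard normal
    (hstd : ∀ n, P.map (X n) = gaussianReal 0 1)
    (lam : ℝ) (hlam : lam ∈ Ioo (0:ℝ) 1)
    -- |Cov(X i, X j)| ≤ λ^{|i-j|}; the means are 0 so Cov(X i, X j) = E[X i · X j]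
    (hcov : ∀ i j : ℕ, |∫ ω, X i ω * X j ω ∂P| ≤ lam ^ ((i : ℤ) - (j : ℤ)).natAbs) :
    ∀ᵐ ω ∂P,
      Tendsto
        (fun n : ℕ => (⨆ j : (Icc 1 n : Set ℕ), X j ω) / Real.sqrt (2 * Real.log n))
        atTop (nhds 1) := by
  have hpair : ∀ i j, i ≠ j → ∃ m : ℝ, ∃ v : NNReal, P.map (X i + X j) = gaussianReal m v := by
    intro i j hij
    obtain ⟨m, v, h⟩ := hjoint {i, j} 1
    refine ⟨m, v, ?_⟩
    rw [← h]
    congr 1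
    ext ω
    simp [Finset.sum_pair hij]
  have hlower : ∀ᵐ ω ∂P, ∀ q : ℚ, (q : ℝ) ∈ Ioo (0 : ℝ) 1 → ∀ᶠ k : ℕ in atTop,
      ∃ i ∈ Finset.Icc 1 (2 ^ k), q * √(2 * (k * Real.log 2)) < X i ω :=
    ae_all_iff.2 fun q => eventually_imp_distrib_left.2 fun hq =>
      ae_eventually_exists_dyadic_lt hmeas hpair hstd hlam hcov hq
  have hupper : ∀ᵐ ω ∂P, ∀ q : ℚ, (1 : ℝ) < q → ∀ᶠ n : ℕ in atTop,
      X n ω < q * √(2 * Real.log n) :=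
    ae_all_iff.2 fun q => eventually_imp_distrib_left.2 fun hq =>
      ae_eventually_lt_mul_sqrt_log hmeas hstd hq
  filter_upwards [hlower, hupper] with ω hlo hup
  refine tendsto_order.2 ⟨fun a ha => ?_, fun a ha => ?_⟩
  · obtain ⟨p, hp, hp1⟩ := exists_rat_btwn (max_lt ha zero_lt_one)
    obtain ⟨q, hpq, hq1⟩ := exists_rat_btwn hp1
    rw [max_lt_iff] at hp
    filter_upwards [eventually_lt_iSup_Icc_div (x := fun j => X j ω) hp.2 hpq
      (hlo q ⟨hp.2.trans hpq, hq1⟩)] with n hn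
    exact hp.1.trans hn
  · obtain ⟨q, hq1, hqa⟩ := exists_rat_btwn ha
    exact eventually_iSup_Icc_div_lt (x := fun j => X j ω) (zero_lt_one.trans hq1) hqa (hup q hq1)
end

section
/- Let μ and ν be ℝ^{d×d}-valued finite Borel measures on [−τ,0] with μ({0}) = 0, satisfying condition (PW). Let ρ₀ be the integral resolvent of −μ₊ (which is then a finite matrix measure on [0,∞)) and set β = ν₊ − ν₊∗ρ₀. For a finite matrix measure α on [0,∞) write α̂(λ) = ∫_{[0,∞)} e^{−λt} α(dt) for Re λ ≥ 0. Then for every λ ∈ ℂ with Re λ ≥ 0, λ I_d − β̂(λ) = [λ(I_d − μ̂₊(λ)) − ν̂₊(λ)] (I_d − μ̂₊(λ))^{−1}; consequently det(λ I_d − β̂(λ)) ≠ 0 for all λ with Re λ ≥ 0 if and only if h_{μ,ν}(λ) ≠ 0 for all λ with Re λ ≥ 0. -/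
open MeasureTheory Filter Set

noncomputable section

/-- Integral of a real-valued function against a finite signed measure, via the Jordan
decomposition. -/
def sInt (s : SignedMeasure ℝ) (f : ℝ → ℝ) : ℝ :=
  (∫ x, f x ∂s.toJordanDecomposition.posPart) -
    ∫ x, f x ∂s.toJordanDecomposition.negPart

/-- Integral of a complex-valued function against a finite signed measure. -/
def sIntC (s : SignedMeasure ℝ) (f : ℝ → ℂ) : ℂ :=
  (∫ x, f x ∂s.toJordanDecomposition.posPart) -
    ∫ x, f x ∂s.toJordanDecomposition.negPart

/-- The signed measure `s` is supported in the set `A`. -/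
def SuppIn (s : SignedMeasure ℝ) (A : Set ℝ) : Prop :=
  ∀ E : Set ℝ, MeasurableSet E → E ∩ A = ∅ → s E = 0

/-- Convolution value `(a ∗ b)(E) = ∫∫ 1_E(s+t) a(ds) b(dt)` of two signed measures. -/
def sConv (a b : SignedMeasure ℝ) (E : Set ℝ) : ℝ :=
  sInt a fun s => sInt b fun t => E.indicator (fun _ => (1 : ℝ)) (s + t)

variable {d : ℕ}

/-- Laplace transform `α̂(z) = ∫_{[0,∞)} e^{−zt} α(dt)` of a matrix of finite signed
measures (supported in `[0,∞)`). -/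
def lapHat (α : Fin d → Fin d → SignedMeasure ℝ) (z : ℂ) : Matrix (Fin d) (Fin d) ℂ :=
  Matrix.of fun i j => sIntC (α i j) fun t => Complex.exp (-(z * t))

/-- Transform `∫ e^{z s} μ(ds)` of a matrix measure supported in `[−τ,0]`. -/
def mHat (μ : Fin d → Fin d → SignedMeasure ℝ) (z : ℂ) : Matrix (Fin d) (Fin d) ℂ :=
  Matrix.of fun i j => sIntC (μ i j) fun s => Complex.exp (z * s)

/-- Condition (PW): `det(I − ∫ e^{λ s} μ(ds)) ≠ 0` for all `Re λ ≥ 0`. -/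
def PW (μ : Fin d → Fin d → SignedMeasure ℝ) : Prop :=
  ∀ z : ℂ, 0 ≤ z.re → Matrix.det (1 - mHat μ z) ≠ 0

/-- The function `h_{μ,ν}(λ) = det(λ(I − ∫ e^{λ s} μ(ds)) − ∫ e^{λ s} ν(ds))`. -/
def hChar (μ ν : Fin d → Fin d → SignedMeasure ℝ) (z : ℂ) : ℂ :=
  Matrix.det (z • (1 - mHat μ z) - mHat ν z)

lemma apply_eq_jordan (s : SignedMeasure ℝ) {E : Set ℝ} (hE : MeasurableSet E) :
    s E = s.toJordanDecomposition.posPart.real E - s.toJordanDecomposition.negPart.real E :=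
  s.apply_eq_posPart_real_sub_negPart_real hE

/-- The Jordan decomposition is dominated by any decomposition into finite measures. -/
lemma jordan_le {s : SignedMeasure ℝ} {p n : Measure ℝ} [IsFiniteMeasure p] [IsFiniteMeasure n]
    (h : ∀ E, MeasurableSet E → s E = p.real E - n.real E) :
    s.toJordanDecomposition.posPart ≤ p ∧ s.toJordanDecomposition.negPart ≤ n := by
  obtain ⟨S, hS, h1, h2⟩ := s.toJordanDecomposition.mutuallySingular
  set P := s.toJordanDecomposition.posPart
  set N := s.toJordanDecomposition.negPart
  have key : ∀ E, MeasurableSet E → P.real E - N.real E = p.real E - n.real E := fun E hE => by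
    rw [← h E hE, apply_eq_jordan s hE]
  constructor
  · refine Measure.le_iff.2 fun E hE => ?_
    have hP : P E = P (E \ S) := (measure_sdiff_null h1).symm
    have hN : N (E \ S) = 0 := measure_mono_null (fun x hx => hx.2) h2
    have := key _ (hE.diff hS)
    rw [Measure.real, Measure.real, hN, ← hP] at this
    have hle : P.real E ≤ p.real E := by
      have h3 : p.real (E \ S) ≤ p.real E := measureReal_mono sdiff_subset
      have h4 : 0 ≤ n.real (E \ S) := measureReal_nonneg
      simp only [ENNReal.toReal_zero] at this
      change P.real E - 0 = _ at this
      linarith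
    exact (ENNReal.toReal_le_toReal (measure_ne_top _ _) (measure_ne_top _ _)).1 hle
  · refine Measure.le_iff.2 fun E hE => ?_
    have hN : N E = N (E \ Sᶜ) := (measure_sdiff_null h2).symm
    have hP : P (E \ Sᶜ) = 0 := measure_mono_null (fun x hx => not_not.1 hx.2) h1
    have := key _ (hE.diff hS.compl)
    rw [Measure.real, Measure.real, hP, ← hN] at this
    have hle : N.real E ≤ n.real E := by
      have h3 : n.real (E \ Sᶜ) ≤ n.real E := measureReal_mono sdiff_subset
      have h4 : 0 ≤ p.real (E \ Sᶜ) := measureReal_nonneg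
      simp only [ENNReal.toReal_zero] at this
      change 0 - N.real E = _ at this
      linarith
    exact (ENNReal.toReal_le_toReal (measure_ne_top _ _) (measure_ne_top _ _)).1 hle

/-- `sIntC` may be computed from any decomposition into finite measures. -/
lemma sIntC_eq_of_decomp {s : SignedMeasure ℝ} {p n : Measure ℝ} [IsFiniteMeasure p]
    [IsFiniteMeasure n] (h : ∀ E, MeasurableSet E → s E = p.real E - n.real E)
    {f : ℝ → ℂ} (hp : Integrable f p) (hn : Integrable f n) :
    sIntC s f = (∫ x, f x ∂p) - ∫ x, f x ∂n := by
  obtain ⟨h1, h2⟩ := jordan_le h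
  have hm : s.toJordanDecomposition.posPart + n = p + s.toJordanDecomposition.negPart := by
    ext E hE
    rw [← ENNReal.toReal_eq_toReal_iff' (measure_ne_top _ _) (measure_ne_top _ _)]
    change Measure.real _ E = Measure.real _ E
    rw [measureReal_add_apply, measureReal_add_apply]
    have := h E hE
    rw [apply_eq_jordan s hE] at this
    linarith
  have := congrArg (fun m : Measure ℝ => ∫ x, f x ∂m) hm
  simp only [integral_add_measure (hp.mono_measure h1) hn,
    integral_add_measure hp (hn.mono_measure h2)] at this
  rw [sIntC]
  linear_combination this

lemma sIntC_neg (s : SignedMeasure ℝ) (f : ℝ → ℂ) : sIntC (-s) f = -sIntC s f := by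
  simp [sIntC, SignedMeasure.toJordanDecomposition_neg]

lemma jordan_ae_mem {s : SignedMeasure ℝ} {A : Set ℝ} (hA : MeasurableSet A) (h : SuppIn s A) :
    (∀ᵐ x ∂s.toJordanDecomposition.posPart, x ∈ A) ∧
      ∀ᵐ x ∂s.toJordanDecomposition.negPart, x ∈ A := by
  set P := s.toJordanDecomposition.posPart
  set N := s.toJordanDecomposition.negPart
  have hle : P ≤ P.restrict A ∧ N ≤ N.restrict A := by
    refine jordan_le fun E hE => ?_
    have h0 := h (E \ A) (hE.diff hA) (by ext; simp)
    have h1 := apply_eq_jordan s hE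
    have h2 := apply_eq_jordan s (hE.diff hA)
    have h3 := measureReal_inter_add_sdiff (μ := P) (s := E) hA
    have h4 := measureReal_inter_add_sdiff (μ := N) (s := E) hA
    rw [measureReal_restrict_apply hE, measureReal_restrict_apply hE]
    linarith
  exact ⟨(Measure.absolutelyContinuous_of_le hle.1).ae_le (ae_restrict_mem hA),
    (Measure.absolutelyContinuous_of_le hle.2).ae_le (ae_restrict_mem hA)⟩

lemma integrable_exp_of_ae {p : Measure ℝ} [IsFiniteMeasure p] {w : ℂ}
    (h : ∀ᵐ t ∂p, w.re * t ≤ 0) : Integrable (fun t : ℝ => Complex.exp (w * t)) p := by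
  refine Integrable.of_bound (by fun_prop) 1 ?_
  filter_upwards [h] with t ht
  rw [Complex.norm_exp]
  simpa using ht

lemma integrable_exp_conv {p q : Measure ℝ} [IsFiniteMeasure p] [IsFiniteMeasure q] {w : ℂ}
    (hp : Integrable (fun t : ℝ => Complex.exp (w * t)) p)
    (hq : Integrable (fun t : ℝ => Complex.exp (w * t)) q) :
    Integrable (fun t : ℝ => Complex.exp (w * t)) (p.conv q) := by
  rw [Measure.conv, integrable_map_measure (by fun_prop) (by fun_prop)]
  refine (hp.mul_prod hq).congr (.of_forall fun x => ?_)
  simp [← Complex.exp_add, mul_add]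

lemma integral_exp_conv {p q : Measure ℝ} [IsFiniteMeasure p] [IsFiniteMeasure q] (w : ℂ) :
    ∫ t : ℝ, Complex.exp (w * t) ∂(p.conv q) =
      (∫ t : ℝ, Complex.exp (w * t) ∂p) * ∫ t : ℝ, Complex.exp (w * t) ∂q := by
  rw [Measure.conv, integral_map (by fun_prop) (by fun_prop), ← integral_prod_mul]
  simp [← Complex.exp_add, mul_add]

lemma integral_indicator_conv (p q : Measure ℝ) [IsFiniteMeasure p] [IsFiniteMeasure q]
    {E : Set ℝ} (hE : MeasurableSet E) :
    ∫ s, ∫ t, E.indicator (fun _ => (1 : ℝ)) (s + t) ∂q ∂p = (p.conv q).real E := by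
  have hm : Measurable (E.indicator fun _ : ℝ => (1 : ℝ)) := measurable_const.indicator hE
  rw [← integral_conv, integral_indicator hE]
  · simp
  · exact (integrable_const 1).indicator hE

lemma integrable_integral_indicator (p q : Measure ℝ) [IsFiniteMeasure p] [IsFiniteMeasure q]
    {E : Set ℝ} (hE : MeasurableSet E) :
    Integrable (fun s => ∫ t, E.indicator (fun _ => (1 : ℝ)) (s + t) ∂q) p := by
  have hm : Measurable (E.indicator fun _ : ℝ => (1 : ℝ)) := measurable_const.indicator hE
  refine Integrable.integral_prod_left (f := fun x : ℝ × ℝ =>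
    E.indicator (fun _ => (1 : ℝ)) (x.1 + x.2)) ?_
  refine Integrable.of_bound (hm.comp measurable_add).aestronglyMeasurable 1
    (.of_forall fun x => ?_)
  by_cases hx : x.1 + x.2 ∈ E <;> simp [hx]

/-- The positive part of the convolution of two signed measures, before cancellation. -/
def convPos (a b : SignedMeasure ℝ) : Measure ℝ :=
  a.toJordanDecomposition.posPart.conv b.toJordanDecomposition.posPart +
    a.toJordanDecomposition.negPart.conv b.toJordanDecomposition.negPart

/-- The negative part of the convolution of two signed measures, before cancellation. -/
def convNeg (a b : SignedMeasure ℝ) : Measure ℝ :=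
  a.toJordanDecomposition.posPart.conv b.toJordanDecomposition.negPart +
    a.toJordanDecomposition.negPart.conv b.toJordanDecomposition.posPart

instance (a b : SignedMeasure ℝ) : IsFiniteMeasure (convPos a b) := by
  unfold convPos; infer_instance

instance (a b : SignedMeasure ℝ) : IsFiniteMeasure (convNeg a b) := by
  unfold convNeg; infer_instance

lemma sConv_eq (a b : SignedMeasure ℝ) {E : Set ℝ} (hE : MeasurableSet E) :
    sConv a b E = (convPos a b).real E - (convNeg a b).real E := by
  rw [convPos, convNeg, measureReal_add_apply, measureReal_add_apply]
  simp only [sConv, sInt]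
  rw [integral_sub (integrable_integral_indicator _ _ hE) (integrable_integral_indicator _ _ hE),
    integral_sub (integrable_integral_indicator _ _ hE) (integrable_integral_indicator _ _ hE)]
  simp only [integral_indicator_conv _ _ hE]
  ring

lemma sIntC_exp_sub_conv {ι : Type*} [Fintype ι] {r c : SignedMeasure ℝ}
    {a b : ι → SignedMeasure ℝ} {w : ℂ} (hw : w.re ≤ 0) (hc : SuppIn c (Ici 0))
    (ha : ∀ l, SuppIn (a l) (Ici 0)) (hb : ∀ l, SuppIn (b l) (Ici 0))
    (h : ∀ E, MeasurableSet E → r E = c E - ∑ l, sConv (a l) (b l) E) :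
    sIntC r (fun t => Complex.exp (w * t)) = sIntC c (fun t => Complex.exp (w * t)) -
      ∑ l, sIntC (a l) (fun t => Complex.exp (w * t)) *
        sIntC (b l) (fun t => Complex.exp (w * t)) := by
  have hint : ∀ s : SignedMeasure ℝ, SuppIn s (Ici 0) →
      Integrable (fun t : ℝ => Complex.exp (w * t)) s.toJordanDecomposition.posPart ∧
      Integrable (fun t : ℝ => Complex.exp (w * t)) s.toJordanDecomposition.negPart := by
    intro s hs
    obtain ⟨h1, h2⟩ := jordan_ae_mem measurableSet_Ici hs
    exact ⟨integrable_exp_of_ae (h1.mono fun t ht => mul_nonpos_of_nonpos_of_nonneg hw ht),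
      integrable_exp_of_ae (h2.mono fun t ht => mul_nonpos_of_nonpos_of_nonneg hw ht)⟩
  have hP : ∀ l, Integrable (fun t : ℝ => Complex.exp (w * t)) (convPos (a l) (b l)) := fun l =>
    (integrable_exp_conv (hint _ (ha l)).1 (hint _ (hb l)).1).add_measure
      (integrable_exp_conv (hint _ (ha l)).2 (hint _ (hb l)).2)
  have hN : ∀ l, Integrable (fun t : ℝ => Complex.exp (w * t)) (convNeg (a l) (b l)) := fun l =>
    (integrable_exp_conv (hint _ (ha l)).1 (hint _ (hb l)).2).add_measure
      (integrable_exp_conv (hint _ (ha l)).2 (hint _ (hb l)).1)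
  have hPs : Integrable (fun t : ℝ => Complex.exp (w * t)) (∑ l, convPos (a l) (b l)) :=
    integrable_finsetSum_measure.2 fun l _ => hP l
  have hNs : Integrable (fun t : ℝ => Complex.exp (w * t)) (∑ l, convNeg (a l) (b l)) :=
    integrable_finsetSum_measure.2 fun l _ => hN l
  have hval : ∀ l, (∫ t : ℝ, Complex.exp (w * t) ∂(convPos (a l) (b l))) -
      ∫ t : ℝ, Complex.exp (w * t) ∂(convNeg (a l) (b l)) =
      sIntC (a l) (fun t => Complex.exp (w * t)) *
        sIntC (b l) (fun t => Complex.exp (w * t)) := by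
    intro l
    obtain ⟨a1, a2⟩ := hint _ (ha l)
    obtain ⟨b1, b2⟩ := hint _ (hb l)
    rw [convPos, convNeg, integral_add_measure (integrable_exp_conv a1 b1)
      (integrable_exp_conv a2 b2), integral_add_measure (integrable_exp_conv a1 b2)
      (integrable_exp_conv a2 b1)]
    simp only [integral_exp_conv, sIntC]
    ring
  rw [sIntC_eq_of_decomp (p := c.toJordanDecomposition.posPart + ∑ l, convNeg (a l) (b l))
    (n := c.toJordanDecomposition.negPart + ∑ l, convPos (a l) (b l)) ?_
    ((hint c hc).1.add_measure hNs) ((hint c hc).2.add_measure hPs),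
    integral_add_measure (hint c hc).1 hNs, integral_add_measure (hint c hc).2 hPs,
    integral_finsetSum_measure fun l _ => hN l, integral_finsetSum_measure fun l _ => hP l]
  · simp only [← hval, Finset.sum_sub_distrib]
    rw [sIntC]
    ring
  · intro E hE
    rw [h E hE, apply_eq_jordan c hE, measureReal_add_apply, measureReal_add_apply]
    simp only [sConv_eq _ _ hE, Finset.sum_sub_distrib]
    simp only [Measure.real, Measure.finsetSum_apply, ENNReal.toReal_sum
      fun l _ => measure_ne_top _ _]
    ring

lemma sIntC_exp_reflect {m m' : SignedMeasure ℝ} {τ : ℝ} (hm : SuppIn m (Icc (-τ) 0))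
    (h : ∀ E, MeasurableSet E → m' E = m (Neg.neg ⁻¹' E)) {z : ℂ} (hz : 0 ≤ z.re) :
    sIntC m' (fun t => Complex.exp (-(z * t))) = sIntC m (fun t => Complex.exp (z * t)) := by
  obtain ⟨h1, h2⟩ := jordan_ae_mem measurableSet_Icc hm
  have hint : ∀ p : Measure ℝ, IsFiniteMeasure p → (∀ᵐ x ∂p, x ∈ Icc (-τ) 0) →
      Integrable (fun t : ℝ => Complex.exp (-(z * t))) (p.map Neg.neg) := by
    intro p _ hp
    rw [integrable_map_measure (by fun_prop) (by fun_prop)]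
    have := integrable_exp_of_ae (w := z) (p := p)
      (hp.mono fun t ht => mul_nonpos_of_nonneg_of_nonpos hz ht.2)
    simpa [Function.comp_def] using this
  rw [sIntC_eq_of_decomp (p := m.toJordanDecomposition.posPart.map Neg.neg)
    (n := m.toJordanDecomposition.negPart.map Neg.neg) ?_ (hint _ inferInstance h1)
    (hint _ inferInstance h2), integral_map (by fun_prop) (by fun_prop),
    integral_map (by fun_prop) (by fun_prop)]
  · simp [sIntC]
  · intro E hE
    rw [h E hE, apply_eq_jordan m (measurable_neg hE), map_measureReal_apply measurable_neg hE,
      map_measureReal_apply measurable_neg hE]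

lemma suppIn_Ici_of_reflect {m m' : SignedMeasure ℝ} {τ : ℝ} (hm : SuppIn m (Icc (-τ) 0))
    (h : ∀ E, MeasurableSet E → m' E = m (Neg.neg ⁻¹' E)) : SuppIn m' (Ici 0) := by
  intro E hE hEA
  rw [h E hE]
  refine hm _ (measurable_neg hE) (eq_empty_of_forall_notMem fun x hx => ?_)
  exact (hEA ▸ ⟨hx.1, by simpa using hx.2.2⟩ : -x ∈ (∅ : Set ℝ))

lemma lapHat_sub_conv {r c a b : Fin d → Fin d → SignedMeasure ℝ} {z : ℂ} (hz : 0 ≤ z.re)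
    (hc : ∀ i j, SuppIn (c i j) (Ici 0)) (ha : ∀ i j, SuppIn (a i j) (Ici 0))
    (hb : ∀ i j, SuppIn (b i j) (Ici 0))
    (h : ∀ i j, ∀ E, MeasurableSet E → r i j E = c i j E - ∑ l, sConv (a i l) (b l j) E) :
    lapHat r z = lapHat c z - lapHat a z * lapHat b z := by
  ext i j
  have := sIntC_exp_sub_conv (w := -z) (by simpa using hz) (hc i j) (fun l => ha i l)
    (fun l => hb l j) (h i j)
  simpa [lapHat, Matrix.mul_apply] using this

/-- under condition (PW), with `ρ₀` the integral resolvent of `−μ₊` and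
`β = ν₊ − ν₊∗ρ₀`, for every `λ` with `Re λ ≥ 0` one has
`λI − β̂(λ) = [λ(I − μ̂₊(λ)) − ν̂₊(λ)](I − μ̂₊(λ))⁻¹`; consequently
`det(λI − β̂(λ)) ≠ 0` for all `Re λ ≥ 0` iff `h_{μ,ν}(λ) ≠ 0` for all `Re λ ≥ 0`. -/
theorem stmt12
    (d : ℕ) (τ : ℝ) (hτ : 0 ≤ τ)
    (μ ν μp νp ρ₀ β : Fin d → Fin d → SignedMeasure ℝ)
    (hμsupp : ∀ i j, SuppIn (μ i j) (Icc (-τ) 0))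
    (hνsupp : ∀ i j, SuppIn (ν i j) (Icc (-τ) 0))
    (hμ0 : ∀ i j, μ i j {0} = 0)
    -- μ₊, ν₊ are the reflections of μ, ν
    (hμp : ∀ i j, ∀ E : Set ℝ, MeasurableSet E → μp i j E = μ i j (Neg.neg ⁻¹' E))
    (hνp : ∀ i j, ∀ E : Set ℝ, MeasurableSet E → νp i j E = ν i j (Neg.neg ⁻¹' E))
    (hPW : PW μ)
    -- ρ₀ is the integral resolvent of −μ₊ : ρ₀ − μ₊∗ρ₀ = −μ₊
    (hρ₀supp : ∀ i j, SuppIn (ρ₀ i j) (Ici 0))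
    (hρ₀ : ∀ i j, ∀ E : Set ℝ, MeasurableSet E →
      ρ₀ i j E - ∑ l, sConv (μp i l) (ρ₀ l j) E = -(μp i j E))
    -- β = ν₊ − ν₊∗ρ₀
    (hβ : ∀ i j, ∀ E : Set ℝ, MeasurableSet E →
      β i j E = νp i j E - ∑ l, sConv (νp i l) (ρ₀ l j) E) :
    (∀ z : ℂ, 0 ≤ z.re →
      z • (1 : Matrix (Fin d) (Fin d) ℂ) - lapHat β z
        = (z • (1 - lapHat μp z) - lapHat νp z) * (1 - lapHat μp z)⁻¹) ∧
    ((∀ z : ℂ, 0 ≤ z.re →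
        Matrix.det (z • (1 : Matrix (Fin d) (Fin d) ℂ) - lapHat β z) ≠ 0) ↔
      (∀ z : ℂ, 0 ≤ z.re → hChar μ ν z ≠ 0)) := by
  have hμps : ∀ i j, SuppIn (μp i j) (Ici 0) := fun i j =>
    suppIn_Ici_of_reflect (hμsupp i j) (hμp i j)
  have hνps : ∀ i j, SuppIn (νp i j) (Ici 0) := fun i j =>
    suppIn_Ici_of_reflect (hνsupp i j) (hνp i j)
  have hM : ∀ z : ℂ, 0 ≤ z.re → lapHat μp z = mHat μ z := fun z hz => by
    ext i j
    simpa [lapHat, mHat] using sIntC_exp_reflect (hμsupp i j) (hμp i j) hz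
  have hN : ∀ z : ℂ, 0 ≤ z.re → lapHat νp z = mHat ν z := fun z hz => by
    ext i j
    simpa [lapHat, mHat] using sIntC_exp_reflect (hνsupp i j) (hνp i j) hz
  have hdet : ∀ z : ℂ, 0 ≤ z.re → IsUnit (1 - lapHat μp z).det := fun z hz => by
    rw [hM z hz]
    exact (hPW z hz).isUnit
  have main : ∀ z : ℂ, 0 ≤ z.re →
      z • (1 : Matrix (Fin d) (Fin d) ℂ) - lapHat β z
        = (z • (1 - lapHat μp z) - lapHat νp z) * (1 - lapHat μp z)⁻¹ := by
    intro z hz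
    have hB := lapHat_sub_conv hz hνps hνps hρ₀supp hβ
    have hR : lapHat (fun i j => -ρ₀ i j) z = lapHat μp z - lapHat μp z * lapHat ρ₀ z := by
      refine lapHat_sub_conv hz hμps hμps hρ₀supp fun i j E hE => ?_
      have := hρ₀ i j E hE
      change -(ρ₀ i j E) = _
      linarith
    have hR' : lapHat (fun i j => -ρ₀ i j) z = -lapHat ρ₀ z := by
      ext i j
      simp [lapHat, sIntC_neg]
    rw [hR'] at hR
    have hinv : (1 - lapHat μp z) * (1 - lapHat ρ₀ z) = 1 := by
      have : (1 - lapHat μp z) * (1 - lapHat ρ₀ z)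
          = 1 - lapHat ρ₀ z - (lapHat μp z - lapHat μp z * lapHat ρ₀ z) := by noncomm_ring
      rw [this, ← hR]
      abel
    rw [sub_mul, smul_mul_assoc, Matrix.mul_nonsing_inv _ (hdet z hz),
      Matrix.inv_eq_right_inv hinv, hB, mul_sub, mul_one]
  refine ⟨main, forall₂_congr fun z hz => ?_⟩
  have hu := hdet z hz
  rw [main z hz, Matrix.det_mul, Matrix.det_nonsing_inv, hChar, ← hM z hz, ← hN z hz]
  simp [hu.ne_zero]

end
end

section
/- Let (I(u))_{u≥0} be a jointly measurable real-valued stochastic process such that for each u ≥ 0, I(u) is Gaussian with mean 0 and variance at most K² for some constant K ≥ 0. Then for every θ ∈ (0,1), almost surely lim_{n→∞} ∫_{n^θ}^{(n+1)^θ} |I(u)| du = 0. -/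
open MeasureTheory ProbabilityTheory Filter Set

open scoped ENNReal NNReal

/-- Jensen's inequality for the power function and a finite, not necessarily normalized, measure. -/
lemma lintegral_enorm_rpow_le_measure_univ_rpow_mul {α : Type*} [MeasurableSpace α]
    (μ : Measure α) {f : α → ℝ} (hf : Measurable f) {p : ℝ≥0} (hp : 1 ≤ p) :
    (∫⁻ x, ‖f x‖ₑ ∂μ) ^ (p : ℝ) ≤ μ univ ^ ((p : ℝ) - 1) * ∫⁻ x, ‖f x‖ₑ ^ (p : ℝ) ∂μ := by
  have hp0 : p ≠ 0 := (zero_lt_one.trans_le hp).ne'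
  have hp0' : (p : ℝ) ≠ 0 := by exact_mod_cast hp0
  have h := eLpNorm_le_eLpNorm_mul_rpow_measure_univ (μ := μ) (f := f) (p := 1) (q := p)
    (by exact_mod_cast hp) hf.aestronglyMeasurable
  rw [eLpNorm_one_eq_lintegral_enorm] at h
  refine (ENNReal.rpow_le_rpow h p.coe_nonneg).trans_eq ?_
  rw [ENNReal.mul_rpow_of_nonneg _ _ p.coe_nonneg, eLpNorm_nnreal_pow_eq_lintegral hp0,
    ← ENNReal.rpow_mul, mul_comm]
  congr 2
  simp only [ENNReal.toReal_one, ENNReal.coe_toReal]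
  field_simp

/-- The absolute moments of centered Gaussian measures scale with the standard deviation. -/
lemma lintegral_enorm_rpow_gaussianReal_le (v : ℝ≥0) {K : ℝ} (hK : 0 ≤ K) (hv : (v : ℝ) ≤ K ^ 2)
    (p : ℝ≥0) :
    ∫⁻ x, ‖x‖ₑ ^ (p : ℝ) ∂gaussianReal 0 v ≤
      ENNReal.ofReal K ^ (p : ℝ) * ∫⁻ x, ‖x‖ₑ ^ (p : ℝ) ∂gaussianReal 0 1 := by
  have hmap : gaussianReal 0 v = (gaussianReal 0 1).map (√(v : ℝ) * ·) := by
    rw [gaussianReal_map_const_mul]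
    congr 1
    · simp
    · ext
      simp
  rw [hmap, lintegral_map (by fun_prop) (by fun_prop), ← lintegral_const_mul _ (by fun_prop)]
  gcongr with x
  rw [enorm_mul, ENNReal.mul_rpow_of_nonneg _ _ p.coe_nonneg,
    Real.enorm_of_nonneg (Real.sqrt_nonneg _)]
  gcongr
  exact Real.sqrt_le_left hK |>.mpr hv

lemma lintegral_enorm_rpow_gaussianReal_lt_top (m : ℝ) (v p : ℝ≥0) :
    ∫⁻ x, ‖x‖ₑ ^ (p : ℝ) ∂gaussianReal m v < ∞ := by
  rcases eq_or_ne p 0 with rfl | hp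
  · simp
  · have h := (memLp_id_gaussianReal (μ := m) (v := v) p).eLpNorm_lt_top
    have h' := eLpNorm_nnreal_pow_eq_lintegral (μ := gaussianReal m v) (f := (id : ℝ → ℝ)) hp
    simp only [id] at h'
    rw [← h']
    exact ENNReal.rpow_lt_top_of_nonneg p.coe_nonneg h.ne

/-- Tonelli and Jensen for a measurable process whose `p`-th moments are bounded by `M`. -/
lemma lintegral_rpow_setLIntegral_enorm_le {Ω : Type*} [MeasurableSpace Ω] (P : Measure Ω)
    [SFinite P] {I : ℝ → Ω → ℝ} (hmeas : Measurable (Function.uncurry I)) {p : ℝ≥0} (hp : 1 ≤ p)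
    {s : Set ℝ} (hs : MeasurableSet s) {M : ℝ≥0∞}
    (hM : ∀ u ∈ s, ∫⁻ ω, ‖I u ω‖ₑ ^ (p : ℝ) ∂P ≤ M) :
    ∫⁻ ω, (∫⁻ u in s, ‖I u ω‖ₑ) ^ (p : ℝ) ∂P ≤ volume s ^ (p : ℝ) * M := by
  have hp' : (1 : ℝ) ≤ p := by exact_mod_cast hp
  have hswap : Measurable fun q : Ω × ℝ => ‖I q.2 q.1‖ₑ ^ (p : ℝ) :=
    ((hmeas.comp measurable_swap).enorm.pow_const _)
  calc ∫⁻ ω, (∫⁻ u in s, ‖I u ω‖ₑ) ^ (p : ℝ) ∂P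
      ≤ ∫⁻ ω, volume s ^ ((p : ℝ) - 1) * (∫⁻ u in s, ‖I u ω‖ₑ ^ (p : ℝ)) ∂P := by
        refine lintegral_mono fun ω => ?_
        simpa using lintegral_enorm_rpow_le_measure_univ_rpow_mul (volume.restrict s)
          (f := fun u => I u ω) (hmeas.comp (measurable_id.prodMk measurable_const)) hp
    _ = volume s ^ ((p : ℝ) - 1) * ∫⁻ u in s, ∫⁻ ω, ‖I u ω‖ₑ ^ (p : ℝ) ∂P := by
        rw [lintegral_const_mul _ hswap.lintegral_prod_right', lintegral_lintegral_swap]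
        exact hswap.aemeasurable
    _ ≤ volume s ^ ((p : ℝ) - 1) * (M * volume s) := by
        gcongr
        exact (setLIntegral_mono' hs hM).trans_eq (setLIntegral_const _ _)
    _ = volume s ^ (p : ℝ) * M := by
        rw [mul_comm M, ← mul_assoc]
        congr 1
        conv_lhs => rw [← ENNReal.rpow_one (volume s), ← ENNReal.rpow_mul, one_mul]
        rw [← ENNReal.rpow_add_of_nonneg _ _ (by linarith) zero_le_one, sub_add_cancel]

lemma add_one_rpow_sub_rpow_le {θ x : ℝ} (hθ₀ : 0 ≤ θ) (hθ₁ : θ ≤ 1) (hx : 0 < x) :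
    (x + 1) ^ θ - x ^ θ ≤ x ^ (θ - 1) := by
  have h : (1 + x⁻¹) ^ θ ≤ 1 + θ * x⁻¹ :=
    rpow_one_add_le_one_add_mul_self (by linarith [inv_pos.2 hx]) hθ₀ hθ₁
  have hfac : (x + 1) ^ θ = x ^ θ * (1 + x⁻¹) ^ θ := by
    rw [← Real.mul_rpow hx.le (by positivity)]
    congr 1
    field_simp
  rw [hfac, Real.rpow_sub_one hx.ne', div_eq_mul_inv]
  have hxθ : 0 < x ^ θ := Real.rpow_pos_of_pos hx θ
  have hinv : 0 < x⁻¹ := inv_pos.2 hx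
  nlinarith [mul_le_mul_of_nonneg_left h hxθ.le,
    mul_le_mul_of_nonneg_left (mul_le_of_le_one_left hinv.le hθ₁) hxθ.le]

/-- Random variables with summable `p`-th moments tend to zero almost surely. -/
lemma ae_tendsto_zero_of_tsum_lintegral_rpow_ne_top {Ω : Type*} [MeasurableSpace Ω]
    {P : Measure Ω} {J : ℕ → Ω → ℝ≥0∞} (hJ : ∀ n, Measurable (J n)) {p : ℝ} (hp : 0 < p)
    (hsum : ∑' n, ∫⁻ ω, J n ω ^ p ∂P ≠ ∞) :
    ∀ᵐ ω ∂P, Tendsto (fun n => J n ω) atTop (nhds 0) := by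
  rw [← lintegral_tsum fun n => ((hJ n).pow_const p).aemeasurable] at hsum
  filter_upwards [ae_lt_top (Measurable.tsum fun n => (hJ n).pow_const p) hsum] with ω hω
  have h := (ENNReal.tendsto_atTop_zero_of_tsum_ne_top hω.ne).ennrpow_const p⁻¹
  simpa [← ENNReal.rpow_mul, hp.ne', hp] using h

/-- If `(I(u))_{u ≥ 0}` is a jointly measurable real-valued process such
that each `I(u)` is Gaussian with mean `0` and variance at most `K²`, then for every
`θ ∈ (0,1)`, almost surely `∫_{n^θ}^{(n+1)^θ} |I(u)| du → 0` as `n → ∞`. -/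
theorem stmt17
    {Ω : Type*} [MeasurableSpace Ω] (P : Measure Ω) [IsProbabilityMeasure P]
    (I : ℝ → Ω → ℝ) (K : ℝ) (hK : 0 ≤ K)
    (hmeas : Measurable (Function.uncurry I))
    (hgauss : ∀ u : ℝ, 0 ≤ u → ∃ v : NNReal, (v : ℝ) ≤ K ^ 2 ∧
      P.map (I u) = gaussianReal 0 v)
    (θ : ℝ) (hθ : θ ∈ Ioo (0:ℝ) 1) :
    ∀ᵐ ω ∂P,
      Tendsto (fun n : ℕ => ∫ u in ((n : ℝ) ^ θ)..(((n : ℝ) + 1) ^ θ), |I u ω|)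
        atTop (nhds 0) := by
  obtain ⟨hθ₀, hθ₁⟩ := hθ
  have hpos : 0 < 1 - θ := by linarith
  obtain ⟨p, hp⟩ : ∃ p : ℝ≥0, (p : ℝ) = 2 / (1 - θ) := ⟨⟨2 / (1 - θ), by positivity⟩, rfl⟩
  have hp1 : 1 ≤ p := by
    rw [← NNReal.coe_le_coe, hp, NNReal.coe_one, le_div_iff₀ hpos]
    linarith
  have hp0 : (0 : ℝ) < p := by rw [hp]; positivity
  let M : ℝ≥0∞ := ENNReal.ofReal K ^ (p : ℝ) * ∫⁻ x, ‖x‖ₑ ^ (p : ℝ) ∂gaussianReal 0 1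
  have hM_top : M ≠ ∞ := ENNReal.mul_ne_top
    (ENNReal.rpow_ne_top_of_nonneg p.coe_nonneg ENNReal.ofReal_ne_top)
    (lintegral_enorm_rpow_gaussianReal_lt_top 0 1 p).ne
  have hM : ∀ u : ℝ, 0 ≤ u → ∫⁻ ω, ‖I u ω‖ₑ ^ (p : ℝ) ∂P ≤ M := by
    intro u hu
    obtain ⟨v, hv, hlaw⟩ := hgauss u hu
    have hIu : Measurable (I u) := hmeas.comp measurable_prodMk_left
    rw [← lintegral_map (f := fun x : ℝ => ‖x‖ₑ ^ (p : ℝ)) (by fun_prop) hIu, hlaw]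
    exact lintegral_enorm_rpow_gaussianReal_le v hK hv p
  let s : ℕ → Set ℝ := fun n => Ioc (((n + 1 : ℕ) : ℝ) ^ θ) ((((n + 1 : ℕ) : ℝ) + 1) ^ θ)
  let J : ℕ → Ω → ℝ≥0∞ := fun n ω => ∫⁻ u in s n, ‖I u ω‖ₑ
  have hJ_meas : ∀ n, Measurable (J n) := fun n =>
    Measurable.lintegral_prod_right' (f := fun q : Ω × ℝ => ‖I q.2 q.1‖ₑ)
      (hmeas.comp measurable_swap).enorm
  have hvol : ∀ n, volume (s n) ^ (p : ℝ) ≤ ENNReal.ofReal ((((n + 1 : ℕ) : ℝ) ^ 2)⁻¹) := by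
    intro n
    have hn : (0 : ℝ) < ((n + 1 : ℕ) : ℝ) := by positivity
    calc volume (s n) ^ (p : ℝ)
        ≤ ENNReal.ofReal (((n + 1 : ℕ) : ℝ) ^ (θ - 1)) ^ (p : ℝ) := by
          rw [Real.volume_Ioc]
          gcongr
          exact add_one_rpow_sub_rpow_le hθ₀.le hθ₁.le hn
      _ = ENNReal.ofReal ((((n + 1 : ℕ) : ℝ) ^ 2)⁻¹) := by
          rw [ENNReal.ofReal_rpow_of_nonneg (by positivity) p.coe_nonneg, ← Real.rpow_mul hn.le,
            show (θ - 1) * (p : ℝ) = -2 by rw [hp]; field_simp; ring, Real.rpow_neg hn.le]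
          norm_cast
  have hsum : ∑' n, ∫⁻ ω, J n ω ^ (p : ℝ) ∂P ≠ ∞ := by
    refine ne_top_of_le_ne_top ?_ (ENNReal.tsum_le_tsum fun n =>
      (lintegral_rpow_setLIntegral_enorm_le P hmeas hp1 measurableSet_Ioc fun u hu =>
        hM u ((Real.rpow_nonneg (Nat.cast_nonneg _) θ).trans hu.1.le)).trans
        (mul_le_mul_left (hvol n) M))
    rw [ENNReal.tsum_mul_right]
    exact ENNReal.mul_ne_top
      ((summable_nat_add_iff 1).2 (Real.summable_nat_pow_inv.2 one_lt_two)).tsum_ofReal_ne_top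
      hM_top
  filter_upwards [ae_tendsto_zero_of_tsum_lintegral_rpow_ne_top hJ_meas hp0 hsum] with ω hω
  rw [← tendsto_add_atTop_iff_nat 1]
  have h := (ENNReal.tendsto_toReal ENNReal.zero_ne_top).comp hω
  rw [ENNReal.toReal_zero] at h
  refine h.congr fun n => ?_
  have hIω : Measurable fun u => I u ω := hmeas.comp measurable_prodMk_right
  rw [intervalIntegral.integral_of_le
    (Real.rpow_le_rpow (Nat.cast_nonneg _) (by linarith) hθ₀.le)]
  exact (integral_norm_eq_lintegral_enorm hIω.aestronglyMeasurable).symm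
end

section
/- Let μ and ν be ℝ^{d×d}-valued finite Borel measures on [−τ,0] with μ({0}) = 0, satisfying condition (PW) and v₀(μ,ν) < 0, so that the resolvent ρ lies in L¹([0,∞);ℝ^{d×d}) and the integral resolvent ρ₀ of −μ₊ is a finite measure. Set κ₁ = ν₊∗ρ (a function in L¹([0,∞);ℝ^{d×d})) and let κ₂ be the finite matrix measure κ₂ = κ₁ dt − ρ₀ − ρ₀∗(κ₁ dt). Let z : [−τ,∞) → ℝ^d be continuous with z(t) = 0 for t ∈ [−τ,0], let n₁, n₂ : [0,∞) → ℝ^d be continuous, and suppose the function u(t) := z(t) − ∫_{[0,t]} μ₊(ds) z(t−s) − n₁(t) is differentiable on (0,∞) with u′(t) = ∫_{[0,t]} ν₊(ds) z(t−s) + n₂(t) and u(0) = −n₁(0). Then for all t ≥ 0, z(t) = n₁(t) − ρ(t) n₁(0) + ∫₀ᵗ ρ(t−s) n₂(s) ds + ∫_{[0,t]} κ₂(ds) n₁(t−s). -/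
open MeasureTheory ProbabilityTheory Filter Set

noncomputable section

variable {d : ℕ}

/-- `v₀(μ,ν) < 0`: the real parts of the zeros of `h_{μ,ν}` are bounded above by some
negative number. -/
def v0Neg (μ ν : Fin d → Fin d → SignedMeasure ℝ) : Prop :=
  ∃ w : ℝ, w < 0 ∧ ∀ z : ℂ, hChar μ ν z = 0 → z.re ≤ w

/-- `ρ` is the resolvent (fundamental solution) of the neutral equation
`d/dt(ρ(t) − ∫ μ(ds) ρ(t+s)) = ∫ ν(ds) ρ(t+s)`, `ρ(0) = I`, `ρ = 0` on `[−τ,0)`. -/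
def IsNeutralResolvent (μ ν : Fin d → Fin d → SignedMeasure ℝ)
    (ρ : ℝ → Fin d → Fin d → ℝ) : Prop :=
  (∀ t : ℝ, t < 0 → ρ t = 0) ∧
  (ρ 0 = fun i j => if i = j then 1 else 0) ∧
  (∀ i j, ContinuousOn (fun t => ρ t i j) (Ici 0)) ∧
  (∀ t ∈ Ici (0:ℝ), ∀ i j,
    HasDerivWithinAt
      (fun u => ρ u i j - ∑ l, sInt (μ i l) fun s => ρ (u + s) l j)
      (∑ l, sInt (ν i l) fun s => ρ (t + s) l j) (Ici 0) t)

/-- `κ₁(t) = (ν₊ ∗ ρ)(t) = ∫_{[0,t]} ν₊(ds) ρ(t−s)` (recall `ρ` vanishes on `(−∞,0)`). -/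
def kappa1 {d : ℕ} (νp : Fin d → Fin d → SignedMeasure ℝ)
    (ρ : ℝ → Fin d → Fin d → ℝ) (t : ℝ) (i j : Fin d) : ℝ :=
  ∑ l, sInt (νp i l) fun s => ρ (t - s) l j

/-- The value on `E` of the convolution of the matrix measure `α` with the measure with
density `g` on `[0,∞)`: `(α ∗ (g dt))(E) = ∫ α(ds) ∫_{(0,∞)} g(t) 1_E(s+t) dt`. -/
def convMeasDens {d : ℕ} (α : Fin d → Fin d → SignedMeasure ℝ)
    (g : ℝ → Fin d → Fin d → ℝ) (E : Set ℝ) (i j : Fin d) : ℝ :=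
  ∑ l, sInt (α i l) fun s =>
    ∫ t in Ioi (0:ℝ), g t l j * E.indicator (fun _ => (1 : ℝ)) (s + t)

instance isFiniteMeasure_totalVariation (s : SignedMeasure ℝ) :
    IsFiniteMeasure s.totalVariation := by
  unfold SignedMeasure.totalVariation; infer_instance

lemma totalVariation_eq_zero {s : SignedMeasure ℝ} {E : Set ℝ} (hE : MeasurableSet E)
    (h : ∀ F ⊆ E, MeasurableSet F → s F = 0) : s.totalVariation E = 0 := by
  obtain ⟨i, hi₁, hi₂, hi₃, hp, hn⟩ := s.toJordanDecomposition_spec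
  have e1 : s (i ∩ E) = 0 := h _ inter_subset_right (hi₁.inter hE)
  have e2 : s (iᶜ ∩ E) = 0 := h _ inter_subset_right (hi₁.compl.inter hE)
  rw [SignedMeasure.totalVariation, Measure.add_apply, hp, hn,
    SignedMeasure.toMeasureOfZeroLE_apply _ _ _ hE, SignedMeasure.toMeasureOfLEZero_apply _ _ _ hE]
  simp [e1, e2]

lemma totalVariation_singleton_eq_zero {s : SignedMeasure ℝ} {x : ℝ} (h : s {x} = 0) :
    s.totalVariation {x} = 0 := by
  refine totalVariation_eq_zero (measurableSet_singleton x) fun F hF _ => ?_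
  rcases subset_singleton_iff_eq.1 hF with rfl | rfl
  · simp
  · exact h

lemma SuppIn.ae_mem {s : SignedMeasure ℝ} {A : Set ℝ} (h : SuppIn s A) (hA : MeasurableSet A) :
    ∀ᵐ x ∂s.totalVariation, x ∈ A := by
  rw [ae_iff]
  refine totalVariation_eq_zero hA.compl fun F hF hFm => h F hFm ?_
  ext x
  simp only [mem_inter_iff, mem_empty_iff_false, iff_false, not_and]
  exact fun hx hxA => hF hx hxA

lemma posPart_le_totalVariation (s : SignedMeasure ℝ) :
    s.toJordanDecomposition.posPart ≤ s.totalVariation := by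
  unfold SignedMeasure.totalVariation; exact Measure.le_add_right le_rfl

lemma negPart_le_totalVariation (s : SignedMeasure ℝ) :
    s.toJordanDecomposition.negPart ≤ s.totalVariation := by
  unfold SignedMeasure.totalVariation; exact Measure.le_add_left le_rfl

lemma sInt_congr {s : SignedMeasure ℝ} {f g : ℝ → ℝ} (h : ∀ᵐ x ∂s.totalVariation, f x = g x) :
    sInt s f = sInt s g := by
  unfold sInt
  rw [integral_congr_ae (ae_mono (posPart_le_totalVariation s) h),
    integral_congr_ae (ae_mono (negPart_le_totalVariation s) h)]

lemma sInt_add {s : SignedMeasure ℝ} {f g : ℝ → ℝ} (hf : Integrable f s.totalVariation)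
    (hg : Integrable g s.totalVariation) :
    sInt s (fun x => f x + g x) = sInt s f + sInt s g := by
  unfold sInt
  rw [integral_add (hf.mono_measure (posPart_le_totalVariation s))
      (hg.mono_measure (posPart_le_totalVariation s)),
    integral_add (hf.mono_measure (negPart_le_totalVariation s))
      (hg.mono_measure (negPart_le_totalVariation s))]
  ring

lemma sInt_const_mul (s : SignedMeasure ℝ) (c : ℝ) (f : ℝ → ℝ) :
    sInt s (fun x => c * f x) = c * sInt s f := by
  unfold sInt
  rw [integral_const_mul, integral_const_mul]
  ring

lemma abs_sInt_le {s : SignedMeasure ℝ} {f g : ℝ → ℝ} (hg : Integrable g s.totalVariation)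
    (h : ∀ᵐ x ∂s.totalVariation, |f x| ≤ g x) : |sInt s f| ≤ ∫ x, g x ∂s.totalVariation := by
  have e : ∫ x, g x ∂s.totalVariation = (∫ x, g x ∂s.toJordanDecomposition.posPart) +
      ∫ x, g x ∂s.toJordanDecomposition.negPart := by
    unfold SignedMeasure.totalVariation
    exact integral_add_measure (hg.mono_measure (posPart_le_totalVariation s))
      (hg.mono_measure (negPart_le_totalVariation s))
  have h1 := norm_integral_le_of_norm_le (hg.mono_measure (posPart_le_totalVariation s))
    (f := f) (ae_mono (posPart_le_totalVariation s) h)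
  have h2 := norm_integral_le_of_norm_le (hg.mono_measure (negPart_le_totalVariation s))
    (f := f) (ae_mono (negPart_le_totalVariation s) h)
  rw [e]
  exact (abs_sub _ _).trans (add_le_add h1 h2)

/-- A functional on functions which, on bounded measurable functions, is integration against a
finite signed measure. -/
def IsMeasureFunctional (L : (ℝ → ℝ) → ℝ) : Prop :=
  ∃ p n : Measure ℝ, IsFiniteMeasure p ∧ IsFiniteMeasure n ∧
    ∀ f, Measurable f → (∃ C, ∀ x, |f x| ≤ C) → L f = (∫ x, f x ∂p) - ∫ x, f x ∂n

lemma integrable_of_abs_le {p : Measure ℝ} [IsFiniteMeasure p] {f : ℝ → ℝ} (hf : Measurable f)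
    (hb : ∃ C, ∀ x, |f x| ≤ C) : Integrable f p := by
  obtain ⟨C, hC⟩ := hb
  exact Integrable.of_bound hf.aestronglyMeasurable C (.of_forall hC)

lemma abs_indicator_one_le (E : Set ℝ) : ∃ C, ∀ x, |E.indicator (fun _ => (1 : ℝ)) x| ≤ C :=
  ⟨1, fun x => by by_cases h : x ∈ E <;> simp [h]⟩

namespace IsMeasureFunctional

lemma of_signedMeasure (s : SignedMeasure ℝ) : IsMeasureFunctional (sInt s) :=
  ⟨s.toJordanDecomposition.posPart, s.toJordanDecomposition.negPart, inferInstance, inferInstance,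
    fun _ _ _ => rfl⟩

lemma add {L M : (ℝ → ℝ) → ℝ} (hL : IsMeasureFunctional L) (hM : IsMeasureFunctional M) :
    IsMeasureFunctional fun f => L f + M f := by
  obtain ⟨p, n, _, _, h⟩ := hL
  obtain ⟨p', n', _, _, h'⟩ := hM
  refine ⟨p + p', n + n', inferInstance, inferInstance, fun f hf hb => ?_⟩
  simp only
  rw [h f hf hb, h' f hf hb, integral_add_measure, integral_add_measure]
  · ring
  all_goals exact integrable_of_abs_le hf hb

lemma neg {L : (ℝ → ℝ) → ℝ} (hL : IsMeasureFunctional L) :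
    IsMeasureFunctional fun f => -L f := by
  obtain ⟨p, n, hp, hn, h⟩ := hL
  refine ⟨n, p, hn, hp, fun f hf hb => ?_⟩
  simp only
  rw [h f hf hb]
  ring

lemma sub {L M : (ℝ → ℝ) → ℝ} (hL : IsMeasureFunctional L) (hM : IsMeasureFunctional M) :
    IsMeasureFunctional fun f => L f - M f := by
  simpa only [sub_eq_add_neg] using hL.add hM.neg

lemma finset_sum {ι : Type*} (t : Finset ι) {L : ι → (ℝ → ℝ) → ℝ}
    (hL : ∀ i, IsMeasureFunctional (L i)) : IsMeasureFunctional fun f => ∑ i ∈ t, L i f := by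
  classical
  induction t using Finset.induction_on with
  | empty => exact ⟨0, 0, inferInstance, inferInstance, fun f _ _ => by simp⟩
  | insert a t ha ih => simpa only [Finset.sum_insert ha] using (hL a).add ih

lemma comp {L M : (ℝ → ℝ) → ℝ} (hL : IsMeasureFunctional L) (hM : IsMeasureFunctional M) :
    IsMeasureFunctional fun f => L fun s => M fun t => f (s + t) := by
  obtain ⟨p, n, _, _, h⟩ := hL
  obtain ⟨p', n', _, _, h'⟩ := hM
  refine ⟨(p.conv p') + (n.conv n'), (p.conv n') + (n.conv p'), inferInstance, inferInstance,
    fun f hf hb => ?_⟩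
  have hM' : ∀ s, (M fun t => f (s + t)) = (∫ t, f (s + t) ∂p') - ∫ t, f (s + t) ∂n' := fun s =>
    h' _ (hf.comp (measurable_const_add s)) (hb.imp fun C hC x => hC _)
  have hm : ∀ q : Measure ℝ, IsFiniteMeasure q → Measurable fun s => ∫ t, f (s + t) ∂q :=
    fun q _ => (StronglyMeasurable.integral_prod_right (ν := q) (f := fun s t => f (s + t))
      (hf.comp measurable_add).stronglyMeasurable).measurable
  have hbd : ∀ q : Measure ℝ, IsFiniteMeasure q → ∃ C, ∀ s, |∫ t, f (s + t) ∂q| ≤ C := by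
    intro q _
    obtain ⟨C, hC⟩ := hb
    exact ⟨C * q.real univ, fun s => norm_integral_le_of_norm_le_const (f := fun t => f (s + t))
      (.of_forall fun x => hC _)⟩
  simp only [hM']
  rw [h (fun s => (∫ t, f (s + t) ∂p') - ∫ t, f (s + t) ∂n') ((hm p' ‹_›).sub (hm n' ‹_›)) ?_,
    integral_sub, integral_sub, integral_add_measure,
    integral_add_measure, integral_conv, integral_conv, integral_conv, integral_conv]
  · ring
  all_goals first
    | exact integrable_of_abs_le hf hb
    | exact integrable_of_abs_le (hm _ inferInstance) (hbd _ inferInstance)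
    | skip
  obtain ⟨C, hC⟩ := hbd p' ‹_›
  obtain ⟨D, hD⟩ := hbd n' ‹_›
  exact ⟨C + D, fun x => (abs_sub _ _).trans (add_le_add (hC x) (hD x))⟩

lemma density {g : ℝ → ℝ} {A : Set ℝ} (hm : Measurable g) (hg : IntegrableOn g A) :
    IsMeasureFunctional fun f => ∫ x in A, g x * f x := by
  refine ⟨(volume.restrict A).withDensity fun x => ENNReal.ofReal (g x),
    (volume.restrict A).withDensity fun x => ENNReal.ofReal (-g x),
    isFiniteMeasure_withDensity_ofReal hg.2, isFiniteMeasure_withDensity_ofReal hg.neg.2,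
    fun f hf hb => ?_⟩
  obtain ⟨C, hC⟩ := hb
  have key : ∀ k : ℝ → ℝ, Measurable k → IntegrableOn k A →
      (∫ x, f x ∂(volume.restrict A).withDensity fun x => ENNReal.ofReal (k x)) =
        ∫ x in A, max (k x) 0 * f x := by
    intro k hk _
    exact integral_withDensity_eq_integral_smul (μ := volume.restrict A)
      (f := fun x => (k x).toNNReal) hk.real_toNNReal f
  rw [key g hm hg, key (fun x => -g x) hm.neg hg.neg, ← integral_sub]
  · refine integral_congr_ae (.of_forall fun x => ?_)
    simp only
    rw [← sub_mul]
    congr 1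
    rcases le_total 0 (g x) with h | h
    · rw [max_eq_left h, max_eq_right (by linarith)]; ring
    · rw [max_eq_right h, max_eq_left (by linarith)]; ring
  · exact (hg.pos_part).mul_bdd (c := C) hf.aestronglyMeasurable (.of_forall hC)
  · exact (hg.neg.pos_part).mul_bdd (c := C) hf.aestronglyMeasurable (.of_forall hC)

lemma eq_of_indicator {L M : (ℝ → ℝ) → ℝ} (hL : IsMeasureFunctional L)
    (hM : IsMeasureFunctional M) {A : Set ℝ} (hA : MeasurableSet A)
    (h : ∀ E ⊆ A, MeasurableSet E →
      L (E.indicator fun _ => 1) = M (E.indicator fun _ => 1))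
    {f : ℝ → ℝ} (hf : Measurable f) (hb : ∃ C, ∀ x, |f x| ≤ C) (hfA : ∀ x ∉ A, f x = 0) :
    L f = M f := by
  obtain ⟨p, n, _, _, hL⟩ := hL
  obtain ⟨p', n', _, _, hM⟩ := hM
  have key : (p + n').restrict A = (p' + n).restrict A := by
    ext E hE
    rw [Measure.restrict_apply hE, Measure.restrict_apply hE]
    have hEA := hE.inter hA
    have := h _ inter_subset_right hEA
    have hi : Measurable ((E ∩ A).indicator fun _ => (1 : ℝ)) := measurable_const.indicator hEA
    rw [hL _ hi (abs_indicator_one_le _), hM _ hi (abs_indicator_one_le _)] at this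
    simp only [integral_indicator_const _ hEA, smul_eq_mul, mul_one] at this
    have e : (p + n').real (E ∩ A) = (p' + n).real (E ∩ A) := by
      rw [measureReal_add_apply, measureReal_add_apply]; linarith
    exact (measureReal_eq_measureReal_iff).1 e
  have e : ∀ q : Measure ℝ, ∫ x in A, f x ∂q = ∫ x, f x ∂q := fun q =>
    setIntegral_eq_integral_of_forall_compl_eq_zero hfA
  have := congrArg (fun q => ∫ x, f x ∂q) key
  simp only [e] at this
  rw [integral_add_measure, integral_add_measure] at this
  · rw [hL f hf hb, hM f hf hb]; linarith
  all_goals exact integrable_of_abs_le hf hb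

end IsMeasureFunctional

lemma sInt_indicator_one (s : SignedMeasure ℝ) {E : Set ℝ} (hE : MeasurableSet E) :
    sInt s (E.indicator fun _ => 1) = s E := by
  rw [s.apply_eq_posPart_real_sub_negPart_real hE]
  simp [sInt, integral_indicator_const _ hE]

lemma sInt_neg_preimage {s r : SignedMeasure ℝ}
    (h : ∀ E : Set ℝ, MeasurableSet E → r E = s (Neg.neg ⁻¹' E)) {f : ℝ → ℝ} (hf : Measurable f)
    (hb : ∃ C, ∀ x, |f x| ≤ C) : sInt s f = sInt r fun x => f (-x) := by
  have hM : IsMeasureFunctional fun f => sInt r fun x => f (-x) := by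
    refine ⟨r.toJordanDecomposition.posPart.map Neg.neg,
      r.toJordanDecomposition.negPart.map Neg.neg,
      inferInstance, inferInstance, fun f hf _ => ?_⟩
    rw [integral_map measurable_neg.aemeasurable hf.aestronglyMeasurable,
      integral_map measurable_neg.aemeasurable hf.aestronglyMeasurable]
    rfl
  refine (IsMeasureFunctional.of_signedMeasure s).eq_of_indicator hM MeasurableSet.univ ?_ hf hb
    (by simp)
  intro E _ hE
  have e : (fun x : ℝ => E.indicator (fun _ => (1 : ℝ)) (-x)) =
      (Neg.neg ⁻¹' E).indicator fun _ => 1 := rfl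
  rw [e, sInt_indicator_one s hE, sInt_indicator_one r (measurable_neg hE), h _ (measurable_neg hE)]
  simp

/-- Measurable, locally bounded functions vanishing on the negative half-line. -/
def causalSubmodule : Submodule ℝ (ℝ → ℝ) where
  carrier := {f | Measurable f ∧ (∀ t < 0, f t = 0) ∧ ∀ T, ∃ C, ∀ t ≤ T, |f t| ≤ C}
  add_mem' := by
    rintro f g ⟨hf, hf0, hfb⟩ ⟨hg, hg0, hgb⟩
    refine ⟨hf.add hg, fun t ht => by simp [hf0 t ht, hg0 t ht], fun T => ?_⟩
    obtain ⟨C, hC⟩ := hfb T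
    obtain ⟨D, hD⟩ := hgb T
    exact ⟨C + D, fun t ht => (abs_add_le _ _).trans (add_le_add (hC t ht) (hD t ht))⟩
  zero_mem' := ⟨measurable_const, fun _ _ => rfl, fun _ => ⟨0, by simp⟩⟩
  smul_mem' := by
    rintro c f ⟨hf, hf0, hfb⟩
    refine ⟨hf.const_smul c, fun t ht => by simp [hf0 t ht], fun T => ?_⟩
    obtain ⟨C, hC⟩ := hfb T
    refine ⟨|c| * C, fun t ht => ?_⟩
    rw [Pi.smul_apply, smul_eq_mul, abs_mul]
    exact mul_le_mul_of_nonneg_left (hC t ht) (abs_nonneg c)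

/-- The type of measurable, locally bounded functions vanishing on the negative half-line. -/
abbrev Causal : Type := causalSubmodule

namespace Causal

lemma measurable (f : Causal) : Measurable f.1 := f.2.1

lemma eq_zero (f : Causal) {t : ℝ} (ht : t < 0) : f.1 t = 0 := f.2.2.1 t ht

lemma exists_bound (f : Causal) (T : ℝ) : ∃ C, 0 ≤ C ∧ ∀ t ≤ T, |f.1 t| ≤ C := by
  obtain ⟨C, hC⟩ := f.2.2.2 T
  exact ⟨C, (abs_nonneg _).trans (hC T le_rfl), hC⟩

lemma sum_apply {ι : Type*} (s : Finset ι) (f : ι → Causal) (t : ℝ) :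
    (∑ i ∈ s, f i).1 t = ∑ i ∈ s, (f i).1 t := by
  have : (∑ i ∈ s, f i).1 = ∑ i ∈ s, (f i).1 := by simp
  rw [this, Finset.sum_apply]

@[simp] lemma coe_add_apply (f g : Causal) (t : ℝ) : (f + g).1 t = f.1 t + g.1 t := rfl

@[simp] lemma coe_sub_apply (f g : Causal) (t : ℝ) : (f - g).1 t = f.1 t - g.1 t := rfl

@[simp] lemma coe_smul_apply (c : ℝ) (f : Causal) (t : ℝ) : (c • f).1 t = c * f.1 t := rfl

lemma integrable_shift (f : Causal) {p : Measure ℝ} [IsFiniteMeasure p] (hp : ∀ᵐ r ∂p, 0 ≤ r)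
    (t : ℝ) : Integrable (fun r => f.1 (t - r)) p := by
  obtain ⟨C, -, hC⟩ := f.exists_bound t
  exact Integrable.of_bound
    (f.measurable.comp (measurable_const.sub measurable_id)).aestronglyMeasurable C
    (hp.mono fun r hr => hC _ (by linarith))

end Causal

lemma sInt_shift_measurable (s : SignedMeasure ℝ) {f : ℝ → ℝ} (hf : Measurable f) :
    Measurable fun t => sInt s fun r => f (t - r) := by
  unfold sInt
  have h : ∀ p : Measure ℝ, IsFiniteMeasure p → Measurable fun t => ∫ r, f (t - r) ∂p :=
    fun p _ => (StronglyMeasurable.integral_prod_right (ν := p) (f := fun t r => f (t - r))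
      (hf.comp measurable_sub).stronglyMeasurable).measurable
  exact (h _ inferInstance).sub (h _ inferInstance)

/-- Convolution of a signed measure on `[0,∞)` with a causal function. -/
def mconv (s : SignedMeasure ℝ) (hs : SuppIn s (Ici 0)) : Causal →ₗ[ℝ] Causal where
  toFun f := ⟨fun t => sInt s fun r => f.1 (t - r), sInt_shift_measurable s f.measurable, by
      intro t ht
      have : sInt s (fun r => f.1 (t - r)) = sInt s fun _ => 0 :=
        sInt_congr ((hs.ae_mem measurableSet_Ici).mono fun r hr => f.eq_zero (by
          have : (0 : ℝ) ≤ r := hr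
          linarith))
      exact this.trans (by simp [sInt]), by
      intro T
      obtain ⟨C, -, hC⟩ := f.exists_bound T
      refine ⟨∫ _, C ∂s.totalVariation, fun t ht => abs_sInt_le (integrable_const C) ?_⟩
      refine (hs.ae_mem measurableSet_Ici).mono fun r hr => hC _ ?_
      have : (0 : ℝ) ≤ r := hr
      linarith⟩
  map_add' f g := by
    ext t
    exact sInt_add (f.integrable_shift (hs.ae_mem measurableSet_Ici) t)
      (g.integrable_shift (hs.ae_mem measurableSet_Ici) t)
  map_smul' c f := by
    ext t
    exact sInt_const_mul s c _

lemma mconv_apply (s : SignedMeasure ℝ) (hs : SuppIn s (Ici 0)) (f : Causal) (t : ℝ) :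
    (mconv s hs f).1 t = sInt s fun r => f.1 (t - r) := rfl

namespace Causal

lemma integrable_mul_shift (f g : Causal) (t : ℝ) :
    Integrable fun x => f.1 x * g.1 (t - x) := by
  have hsupp : Function.support (fun x => f.1 x * g.1 (t - x)) ⊆ Icc 0 t := by
    intro x hx
    by_contra hxt
    refine hx ?_
    rcases lt_or_ge x 0 with h | h
    · simp [f.eq_zero h]
    · have : t < x := by
        by_contra h'
        exact hxt ⟨h, not_lt.1 h'⟩
      simp [g.eq_zero (show t - x < 0 by linarith)]
  rw [← integrableOn_iff_integrable_of_support_subset hsupp]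
  obtain ⟨C, hC0, hC⟩ := f.exists_bound t
  obtain ⟨D, hD0, hD⟩ := g.exists_bound t
  refine Measure.integrableOn_of_bounded (M := C * D) measure_Icc_lt_top.ne
    (f.measurable.mul (g.measurable.comp (measurable_const.sub measurable_id))).aestronglyMeasurable ?_
  refine (ae_restrict_iff' measurableSet_Icc).2 (.of_forall fun x hx => ?_)
  rw [norm_mul]
  exact mul_le_mul (hC x hx.2) (hD _ (by linarith [hx.1])) (norm_nonneg _) hC0

lemma integral_eq_setIntegral (f g : Causal) {t T : ℝ} (hT : t ≤ T) :
    ∫ x, f.1 x * g.1 (t - x) = ∫ x in Icc 0 T, f.1 x * g.1 (t - x) := by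
  refine (setIntegral_eq_integral_of_forall_compl_eq_zero fun x hx => ?_).symm
  rcases lt_or_ge x 0 with h | h
  · simp [f.eq_zero h]
  · have : T < x := by
      by_contra h'
      exact hx ⟨h, not_lt.1 h'⟩
    simp [g.eq_zero (show t - x < 0 by linarith)]

/-- Convolution of causal functions. -/
def conv (f : Causal) : Causal →ₗ[ℝ] Causal where
  toFun g := ⟨fun t => ∫ x, f.1 x * g.1 (t - x),
    (StronglyMeasurable.integral_prod_right (ν := volume) (f := fun t x => f.1 x * g.1 (t - x))
      ((f.measurable.comp measurable_snd).mul
        (g.measurable.comp measurable_sub)).stronglyMeasurable).measurable, by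
      intro t ht
      have : ∀ x, f.1 x * g.1 (t - x) = 0 := by
        intro x
        rcases lt_or_ge x 0 with h | h
        · simp [f.eq_zero h]
        · simp [g.eq_zero (show t - x < 0 by linarith)]
      simp [this], by
      intro T
      obtain ⟨C, hC0, hC⟩ := f.exists_bound T
      obtain ⟨D, hD0, hD⟩ := g.exists_bound T
      refine ⟨C * D * volume.real (Icc 0 T), fun t ht => ?_⟩
      simp only
      rw [integral_eq_setIntegral f g ht]
      refine norm_setIntegral_le_of_norm_le_const (f := fun x => f.1 x * g.1 (t - x))
        measure_Icc_lt_top fun x hx => ?_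
      rw [norm_mul]
      exact mul_le_mul (hC x hx.2) (hD _ (by linarith [hx.1])) (norm_nonneg _) hC0⟩
  map_add' g k := by
    ext t
    simp only [coe_add_apply, mul_add]
    exact integral_add (f.integrable_mul_shift g t) (f.integrable_mul_shift k t)
  map_smul' c g := by
    ext t
    simp only [coe_smul_apply, RingHom.id_apply]
    rw [← integral_const_mul]
    congr 1 with x
    ring

lemma conv_apply (f g : Causal) (t : ℝ) : (f.conv g).1 t = ∫ x, f.1 x * g.1 (t - x) := rfl

lemma conv_comm (f g : Causal) : f.conv g = g.conv f := by
  ext t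
  rw [conv_apply, conv_apply, ← integral_sub_left_eq_self _ volume t]
  congr 1 with x
  rw [sub_sub_cancel, mul_comm]

/-- Absolute value of a causal function. -/
def abs (f : Causal) : Causal :=
  ⟨fun t => ‖f.1 t‖, f.measurable.norm, fun t ht => by simp [f.eq_zero ht], fun T => by
    obtain ⟨C, -, hC⟩ := f.exists_bound T
    exact ⟨C, fun t ht => by simpa using hC t ht⟩⟩

lemma conv_assoc (f g k : Causal) : (f.conv g).conv k = f.conv (g.conv k) := by
  ext t
  exact convolution_assoc (ContinuousLinearMap.mul ℝ ℝ) (ContinuousLinearMap.mul ℝ ℝ)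
    (ContinuousLinearMap.mul ℝ ℝ) (ContinuousLinearMap.mul ℝ ℝ) (μ := volume) (ν := volume)
    (fun x y z => mul_assoc x y z)
    f.measurable.aestronglyMeasurable g.measurable.aestronglyMeasurable
    k.measurable.aestronglyMeasurable (.of_forall fun y => f.integrable_mul_shift g y)
    (.of_forall fun y => g.abs.integrable_mul_shift k.abs y)
    (f.abs.integrable_mul_shift (g.abs.conv k.abs) t)

lemma add_conv (f g k : Causal) : (f + g).conv k = f.conv k + g.conv k := by
  rw [conv_comm, map_add, conv_comm k, conv_comm k]

lemma sum_conv {ι : Type*} (s : Finset ι) (f : ι → Causal) (k : Causal) :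
    (∑ i ∈ s, f i).conv k = ∑ i ∈ s, (f i).conv k := by
  rw [conv_comm, map_sum]
  exact Finset.sum_congr rfl fun i _ => conv_comm _ _

end Causal

open Causal in
lemma mconv_conv (s : SignedMeasure ℝ) (hs : SuppIn s (Ici 0)) (f g : Causal) :
    mconv s hs (f.conv g) = (mconv s hs f).conv g := by
  ext t
  have h0 : ∀ᵐ r ∂s.totalVariation, 0 ≤ r := hs.ae_mem measurableSet_Ici
  have hG : Measurable (fun q : ℝ × ℝ => f.1 (q.2 - q.1) * g.1 (t - q.2)) :=
    (f.measurable.comp (measurable_snd.sub measurable_fst)).mul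
      (g.measurable.comp (measurable_const.sub measurable_snd))
  obtain ⟨C, hC0, hC⟩ := f.exists_bound t
  obtain ⟨D, hD0, hD⟩ := g.exists_bound t
  have key : ∀ p : Measure ℝ, IsFiniteMeasure p → (∀ᵐ r ∂p, 0 ≤ r) →
      ∫ r, (f.conv g).1 (t - r) ∂p = ∫ x in Icc 0 t, (∫ r, f.1 (x - r) ∂p) * g.1 (t - x) := by
    intro p _ hp
    have e1 : ∫ r, (f.conv g).1 (t - r) ∂p =
        ∫ r, (∫ x in Icc 0 t, f.1 (x - r) * g.1 (t - x)) ∂p := by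
      refine integral_congr_ae (hp.mono fun r hr => ?_)
      simp only
      rw [conv_apply, ← integral_sub_right_eq_self _ r]
      have : ∀ x, t - r - (x - r) = t - x := fun x => by ring
      simp only [this]
      refine (setIntegral_eq_integral_of_forall_compl_eq_zero fun x hx => ?_).symm
      rcases lt_or_ge x 0 with h | h
      · simp [f.eq_zero (show x - r < 0 by linarith)]
      · have : t < x := by
          by_contra h'
          exact hx ⟨h, not_lt.1 h'⟩
        simp [g.eq_zero (show t - x < 0 by linarith)]
    have hint : Integrable (fun q : ℝ × ℝ => f.1 (q.2 - q.1) * g.1 (t - q.2))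
        (p.prod (volume.restrict (Icc 0 t))) := by
      refine Integrable.of_bound hG.aestronglyMeasurable (C * D) ?_
      have h1 : ∀ᵐ q ∂p.prod (volume.restrict (Icc 0 t)), 0 ≤ q.1 :=
        Measure.quasiMeasurePreserving_fst.ae hp
      have h2 : ∀ᵐ q ∂p.prod (volume.restrict (Icc 0 t)), q.2 ∈ Icc 0 t :=
        Measure.quasiMeasurePreserving_snd.ae (ae_restrict_mem measurableSet_Icc)
      filter_upwards [h1, h2] with q hq1 hq2
      rw [norm_mul]
      exact mul_le_mul (hC _ (by linarith [hq2.2])) (hD _ (by linarith [hq2.1])) (norm_nonneg _) hC0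
    rw [e1, integral_integral_swap hint]
    congr 1 with x
    rw [integral_mul_const]
  have hsub : ∀ p : Measure ℝ, IsFiniteMeasure p → (∀ᵐ r ∂p, 0 ≤ r) →
      IntegrableOn (fun x => (∫ r, f.1 (x - r) ∂p) * g.1 (t - x)) (Icc 0 t) := by
    intro p _ hp
    have hm : Measurable fun x => ∫ r, f.1 (x - r) ∂p :=
      (StronglyMeasurable.integral_prod_right (ν := p) (f := fun x r => f.1 (x - r))
        (f.measurable.comp measurable_sub).stronglyMeasurable).measurable
    refine Measure.integrableOn_of_bounded (M := C * p.real univ * D) measure_Icc_lt_top.ne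
      (hm.mul (g.measurable.comp (measurable_const.sub measurable_id))).aestronglyMeasurable ?_
    refine (ae_restrict_iff' measurableSet_Icc).2 (.of_forall fun x hx => ?_)
    rw [norm_mul]
    refine mul_le_mul (norm_integral_le_of_norm_le_const (hp.mono fun r hr => ?_))
      (hD _ (by linarith [hx.1])) (norm_nonneg _) (mul_nonneg hC0 measureReal_nonneg)
    exact hC _ (by linarith [hx.2])
  have hp := ae_mono (posPart_le_totalVariation s) h0
  have hn := ae_mono (negPart_le_totalVariation s) h0
  rw [mconv_apply, conv_apply, integral_eq_setIntegral _ _ le_rfl, sInt, key _ inferInstance hp,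
    key _ inferInstance hn, ← integral_sub (hsub _ inferInstance hp) (hsub _ inferInstance hn)]
  congr 1 with x
  rw [← sub_mul]
  rfl

/-- The Heaviside function. -/
def heaviside : Causal :=
  ⟨(Ici (0 : ℝ)).indicator fun _ => 1, measurable_const.indicator measurableSet_Ici,
    fun t ht => by simp [ht], fun _ => ⟨1, fun t _ => by
      by_cases h : 0 ≤ t <;> simp [indicator, h]⟩⟩

lemma heaviside_apply {t : ℝ} (ht : 0 ≤ t) : heaviside.1 t = 1 := by
  simp [heaviside, ht]

lemma heaviside_conv_apply (f : Causal) {t : ℝ} (ht : 0 ≤ t) :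
    (heaviside.conv f).1 t = ∫ x in (0 : ℝ)..t, f.1 x := by
  rw [Causal.conv_comm, Causal.conv_apply, Causal.integral_eq_setIntegral _ _ le_rfl,
    integral_Icc_eq_integral_Ioc, intervalIntegral.integral_of_le ht]
  refine setIntegral_congr_fun measurableSet_Ioc fun x hx => ?_
  rw [heaviside_apply (sub_nonneg.2 hx.2), mul_one]

lemma Causal.ext_nonneg {f g : Causal} (h : ∀ t, 0 ≤ t → f.1 t = g.1 t) : f = g := by
  ext t
  rcases lt_or_ge t 0 with ht | ht
  · rw [f.eq_zero ht, g.eq_zero ht]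
  · exact h t ht

lemma Causal.intervalIntegrable (f : Causal) (a b : ℝ) : IntervalIntegrable f.1 volume a b := by
  obtain ⟨C, -, hC⟩ := f.exists_bound (max a b)
  refine (intervalIntegrable_const (c := C)).mono_fun f.measurable.aestronglyMeasurable ?_
  refine (ae_restrict_iff' measurableSet_uIoc).2 (.of_forall fun x hx => ?_)
  exact (hC x hx.2).trans (le_abs_self C)

lemma abs_heaviside_conv_le {f : Causal} {K c T : ℝ} (hc : 0 < c) (hK : 0 ≤ K)
    (hf : ∀ t ≤ T, |f.1 t| ≤ K * Real.exp (c * t)) :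
    ∀ t ≤ T, |(heaviside.conv f).1 t| ≤ K * c⁻¹ * Real.exp (c * t) := by
  intro t ht
  rcases lt_or_ge t 0 with h | h
  · rw [Causal.eq_zero _ h, abs_zero]
    positivity
  · rw [heaviside_conv_apply f h]
    have hint : IntervalIntegrable (fun x => K * Real.exp (c * x)) volume 0 t :=
      (by fun_prop : Continuous fun x => K * Real.exp (c * x)).intervalIntegrable _ _
    have := intervalIntegral.norm_integral_le_of_norm_le h (f := f.1)
      (.of_forall fun x hx => hf x (hx.2.trans ht)) hint
    refine this.trans ?_
    rw [intervalIntegral.integral_const_mul,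
      intervalIntegral.integral_comp_mul_left (fun x => Real.exp x) hc.ne', integral_exp, smul_eq_mul,
      mul_zero, Real.exp_zero, mul_assoc]
    refine mul_le_mul_of_nonneg_left (mul_le_mul_of_nonneg_left ?_ (by positivity)) hK
    linarith

/-- The Laplace transform of the total variation of a signed measure. -/
def tvLaplace (s : SignedMeasure ℝ) (c : ℝ) : ℝ := ∫ r, Real.exp (-(c * r)) ∂s.totalVariation

lemma tvLaplace_nonneg (s : SignedMeasure ℝ) (c : ℝ) : 0 ≤ tvLaplace s c :=
  integral_nonneg fun _ => (Real.exp_pos _).le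

lemma tendsto_tvLaplace {s : SignedMeasure ℝ} (hs : SuppIn s (Ici 0)) :
    Tendsto (tvLaplace s) atTop (nhds (s.totalVariation.real {0})) := by
  have h0 : ∀ᵐ r ∂s.totalVariation, 0 ≤ r := hs.ae_mem measurableSet_Ici
  have e : s.totalVariation.real {0} =
      ∫ r, ({0} : Set ℝ).indicator (fun _ => (1 : ℝ)) r ∂s.totalVariation := by
    rw [integral_indicator_const _ (measurableSet_singleton 0)]; simp
  rw [e]
  refine tendsto_integral_filter_of_dominated_convergence (fun _ => 1)
    (.of_forall fun c => (by fun_prop : Continuous fun r => Real.exp (-(c * r))).aestronglyMeasurable)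
    ?_ (integrable_const _) (h0.mono fun r hr => ?_)
  · filter_upwards [eventually_ge_atTop 0] with c hc
    filter_upwards [h0] with r hr
    rw [Real.norm_eq_abs, abs_of_pos (Real.exp_pos _), Real.exp_le_one_iff]
    exact neg_nonpos.2 (mul_nonneg hc hr)
  · rcases hr.eq_or_lt with rfl | hr
    · simp
    · rw [indicator_of_notMem (by simpa using hr.ne')]
      exact Real.tendsto_exp_neg_atTop_nhds_zero.comp (tendsto_id.atTop_mul_const hr)

lemma abs_mconv_le {s : SignedMeasure ℝ} (hs : SuppIn s (Ici 0)) {f : Causal} {K c T : ℝ}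
    (hc : 0 < c) (hf : ∀ t ≤ T, |f.1 t| ≤ K * Real.exp (c * t)) :
    ∀ t ≤ T, |(mconv s hs f).1 t| ≤ K * tvLaplace s c * Real.exp (c * t) := by
  intro t ht
  have h0 : ∀ᵐ r ∂s.totalVariation, 0 ≤ r := hs.ae_mem measurableSet_Ici
  have hi : Integrable (fun r => Real.exp (-(c * r))) s.totalVariation := by
    refine Integrable.of_bound (by fun_prop : Continuous _).aestronglyMeasurable 1 ?_
    filter_upwards [h0] with r hr
    rw [Real.norm_eq_abs, abs_of_pos (Real.exp_pos _), Real.exp_le_one_iff]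
    exact neg_nonpos.2 (mul_nonneg hc.le hr)
  rw [mconv_apply]
  refine (abs_sInt_le (hi.const_mul (K * Real.exp (c * t))) ?_).trans (le_of_eq ?_)
  · filter_upwards [h0] with r hr
    refine (hf (t - r) (by linarith)).trans (le_of_eq ?_)
    rw [mul_assoc, ← Real.exp_add]
    ring_nf
  · rw [integral_const_mul, tvLaplace]
    ring

/-- Convolution of a matrix of signed measures on `[0,∞)` with a vector of causal functions. -/
def matConv (M : Fin d → Fin d → SignedMeasure ℝ) (hM : ∀ i j, SuppIn (M i j) (Ici 0)) :
    Module.End ℝ (Fin d → Causal) :=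
  LinearMap.pi fun i => ∑ l, (mconv (M i l) (hM i l)).comp (LinearMap.proj l)

lemma matConv_apply (M : Fin d → Fin d → SignedMeasure ℝ) (hM : ∀ i j, SuppIn (M i j) (Ici 0))
    (f : Fin d → Causal) (i : Fin d) : matConv M hM f i = ∑ l, mconv (M i l) (hM i l) (f l) := by
  simp [matConv]

lemma matConv_apply_apply (M : Fin d → Fin d → SignedMeasure ℝ)
    (hM : ∀ i j, SuppIn (M i j) (Ici 0)) (f : Fin d → Causal) (i : Fin d) (t : ℝ) :
    (matConv M hM f i).1 t = ∑ l, sInt (M i l) fun r => (f l).1 (t - r) := by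
  rw [matConv_apply, Causal.sum_apply]
  rfl

/-- Convolution of a matrix of causal functions with a vector of causal functions. -/
def funConv (R : Fin d → Fin d → Causal) : Module.End ℝ (Fin d → Causal) :=
  LinearMap.pi fun i => ∑ l, (R i l).conv.comp (LinearMap.proj l)

lemma funConv_apply (R : Fin d → Fin d → Causal) (f : Fin d → Causal) (i : Fin d) :
    funConv R f i = ∑ l, (R i l).conv (f l) := by
  simp [funConv]

/-- Componentwise integration of a vector of causal functions. -/
def integ : Module.End ℝ (Fin d → Causal) :=
  LinearMap.pi fun i => heaviside.conv.comp (LinearMap.proj i)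

lemma integ_apply (f : Fin d → Causal) (i : Fin d) : integ f i = heaviside.conv (f i) := rfl

lemma integ_matConv (M : Fin d → Fin d → SignedMeasure ℝ) (hM : ∀ i j, SuppIn (M i j) (Ici 0))
    (f : Fin d → Causal) : integ (matConv M hM f) = matConv M hM (integ f) := by
  ext1 i
  rw [integ_apply, matConv_apply, matConv_apply, map_sum]
  refine Finset.sum_congr rfl fun l _ => ?_
  rw [integ_apply, Causal.conv_comm, ← mconv_conv, Causal.conv_comm]

lemma volterra_unique {μ ν : Fin d → Fin d → SignedMeasure ℝ}
    (hμ : ∀ i j, SuppIn (μ i j) (Ici 0)) (hν : ∀ i j, SuppIn (ν i j) (Ici 0))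
    (hμ0 : ∀ i j, μ i j {0} = 0) {e : Fin d → Causal}
    (he : e = matConv μ hμ e + integ (matConv ν hν e)) : e = 0 := by
  have htv : ∀ i j, (μ i j).totalVariation.real {0} = 0 := by
    intro i j
    rw [measureReal_def, totalVariation_singleton_eq_zero (hμ0 i j), ENNReal.toReal_zero]
  have hlim : Tendsto (fun c => ∑ i, ∑ l, (tvLaplace (μ i l) c + tvLaplace (ν i l) c * c⁻¹)) atTop
      (nhds 0) := by
    have : (0 : ℝ) = ∑ i : Fin d, ∑ l : Fin d,
        ((μ i l).totalVariation.real {0} + (ν i l).totalVariation.real {0} * 0) := by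
      simp [htv]
    rw [this]
    exact tendsto_finsetSum _ fun i _ => tendsto_finsetSum _ fun l _ =>
      (tendsto_tvLaplace (hμ i l)).add ((tendsto_tvLaplace (hν i l)).mul tendsto_inv_atTop_zero)
  obtain ⟨c, hc, hc0⟩ := ((hlim.eventually_le_const (show (0 : ℝ) < 1 / 2 by norm_num)).and
    (eventually_gt_atTop 0)).exists
  have hnn : ∀ i l, 0 ≤ tvLaplace (μ i l) c + tvLaplace (ν i l) c * c⁻¹ := fun i l =>
    add_nonneg (tvLaplace_nonneg _ _) (mul_nonneg (tvLaplace_nonneg _ _) (inv_nonneg.2 hc0.le))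
  have hrow : ∀ i, ∑ l, (tvLaplace (μ i l) c + tvLaplace (ν i l) c * c⁻¹) ≤ 1 / 2 := fun i =>
    (Finset.single_le_sum (f := fun i => ∑ l, (tvLaplace (μ i l) c + tvLaplace (ν i l) c * c⁻¹))
      (fun i _ => Finset.sum_nonneg fun l _ => hnn i l) (Finset.mem_univ i)).trans hc
  have step : ∀ T K : ℝ, 0 ≤ K → (∀ i, ∀ t ≤ T, |(e i).1 t| ≤ K * Real.exp (c * t)) →
      ∀ i, ∀ t ≤ T, |(e i).1 t| ≤ K / 2 * Real.exp (c * t) := by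
    intro T K hK h i t ht
    have h1 : (e i).1 t = ∑ l, ((mconv (μ i l) (hμ i l) (e l)).1 t +
        (heaviside.conv (mconv (ν i l) (hν i l) (e l))).1 t) := by
      conv_lhs => rw [he]
      rw [Pi.add_apply, integ_apply, matConv_apply, matConv_apply, map_sum, Causal.coe_add_apply,
        Causal.sum_apply, Causal.sum_apply, Finset.sum_add_distrib]
    rw [h1]
    calc _ ≤ ∑ l, (K * tvLaplace (μ i l) c * Real.exp (c * t) +
          K * tvLaplace (ν i l) c * c⁻¹ * Real.exp (c * t)) := by
          refine (Finset.abs_sum_le_sum_abs _ _).trans (Finset.sum_le_sum fun l _ => ?_)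
          exact (abs_add_le _ _).trans (add_le_add (abs_mconv_le (hμ i l) hc0 (h l) t ht)
            (abs_heaviside_conv_le hc0 (mul_nonneg hK (tvLaplace_nonneg _ _))
              (abs_mconv_le (hν i l) hc0 (h l)) t ht))
      _ = K * (∑ l, (tvLaplace (μ i l) c + tvLaplace (ν i l) c * c⁻¹)) * Real.exp (c * t) := by
          rw [Finset.mul_sum, Finset.sum_mul]
          exact Finset.sum_congr rfl fun l _ => by ring
      _ ≤ K * (1 / 2) * Real.exp (c * t) := by
          gcongr
          exact hrow i
      _ = _ := by ring
  ext1 i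
  refine Causal.ext_nonneg fun T hT => ?_
  choose C hC0 hC using fun i => (e i).exists_bound T
  have hstart : ∀ i, ∀ t ≤ T, |(e i).1 t| ≤ (∑ l, C l) * Real.exp (c * t) := by
    intro i t ht
    rcases lt_or_ge t 0 with h | h
    · rw [Causal.eq_zero _ h, abs_zero]
      exact mul_nonneg (Finset.sum_nonneg fun l _ => hC0 l) (Real.exp_pos _).le
    · calc |(e i).1 t| ≤ C i := hC i t ht
        _ ≤ ∑ l, C l := Finset.single_le_sum (fun l _ => hC0 l) (Finset.mem_univ i)
        _ ≤ _ := le_mul_of_one_le_right (Finset.sum_nonneg fun l _ => hC0 l)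
          (Real.one_le_exp (by positivity))
  have hall : ∀ n : ℕ, ∀ i, ∀ t ≤ T, |(e i).1 t| ≤ (∑ l, C l) / 2 ^ n * Real.exp (c * t) := by
    intro n
    induction n with
    | zero => simpa using hstart
    | succ n ih =>
      have hC' := Finset.sum_nonneg fun l (_ : l ∈ Finset.univ) => hC0 l
      have := step T _ (by positivity) ih
      rwa [div_div, ← pow_succ] at this
  have hz : Tendsto (fun n : ℕ => (∑ l, C l) / 2 ^ n * Real.exp (c * T)) atTop (nhds 0) := by
    have := ((tendsto_inv_atTop_zero.comp (tendsto_pow_atTop_atTop_of_one_lt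
      (one_lt_two (α := ℝ)))).const_mul (∑ l, C l)).mul_const (Real.exp (c * T))
    simpa [div_eq_mul_inv] using this
  have := ge_of_tendsto' hz fun n => hall n i T le_rfl
  simpa using this

lemma matConv_funConv (M : Fin d → Fin d → SignedMeasure ℝ) (hM : ∀ i j, SuppIn (M i j) (Ici 0))
    (R : Fin d → Fin d → Causal) (f : Fin d → Causal) :
    matConv M hM (funConv R f) =
      funConv (fun i j => ∑ l, mconv (M i l) (hM i l) (R l j)) f := by
  ext1 i
  simp only [matConv_apply, funConv_apply, map_sum, Causal.sum_conv, mconv_conv]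
  exact Finset.sum_comm

lemma Causal.zero_conv (k : Causal) : (0 : Causal).conv k = 0 := by
  rw [conv_comm, map_zero]

lemma integ_funConv (R : Fin d → Fin d → Causal) (f : Fin d → Causal) :
    integ (funConv R f) = funConv (fun i j => heaviside.conv (R i j)) f := by
  ext1 i
  simp only [integ_apply, funConv_apply, map_sum, Causal.conv_assoc]

/-- The variation of constants formula as an identity between causal functions. -/
lemma causal_representation {μ ν ρ₀ : Fin d → Fin d → SignedMeasure ℝ}
    (hμ : ∀ i j, SuppIn (μ i j) (Ici 0)) (hν : ∀ i j, SuppIn (ν i j) (Ici 0))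
    (hρ₀ : ∀ i j, SuppIn (ρ₀ i j) (Ici 0)) (hμ0 : ∀ i j, μ i j {0} = 0)
    {R : Fin d → Fin d → Causal}
    (hR : ∀ i j, R i j = ∑ l, mconv (μ i l) (hμ i l) (R l j) + (if i = j then heaviside else 0) +
      heaviside.conv (∑ l, mconv (ν i l) (hν i l) (R l j)))
    (hres : ∀ f, matConv ρ₀ hρ₀ f - matConv μ hμ (matConv ρ₀ hρ₀ f) = -matConv μ hμ f)
    {z N N₂ : Fin d → Causal} {c : Fin d → ℝ}
    (hz : z = matConv μ hμ z + N - (fun i => c i • heaviside) + integ (matConv ν hν z) + integ N₂) :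
    z = N - (fun i => ∑ l, c l • R i l) + funConv R N₂ + matConv ν hν (funConv R N) -
      matConv ρ₀ hρ₀ (N + matConv ν hν (funConv R N)) := by
  have hP : ∀ f, funConv R f =
      matConv μ hμ (funConv R f) + integ f + integ (matConv ν hν (funConv R f)) := by
    intro f
    rw [matConv_funConv, matConv_funConv, integ_funConv]
    ext1 i
    simp only [Pi.add_apply, funConv_apply, integ_apply]
    conv_lhs => enter [2, l]; rw [hR i l]
    simp only [Causal.add_conv, Finset.sum_add_distrib]
    congr 2
    rw [Finset.sum_eq_single i (fun j _ hj => by rw [if_neg hj.symm, Causal.zero_conv])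
      (fun h => (h (Finset.mem_univ i)).elim), if_pos rfl]
  have hRc : (fun i => ∑ l, c l • R i l) = matConv μ hμ (fun i => ∑ l, c l • R i l) +
      (fun i => c i • heaviside) + integ (matConv ν hν fun i => ∑ l, c l • R i l) := by
    ext1 i
    simp only [Pi.add_apply, integ_apply, matConv_apply, map_sum, map_smul]
    conv_lhs => enter [2, l]; rw [hR i l]
    simp only [smul_add, Finset.sum_add_distrib, Finset.smul_sum, map_sum]
    exact congrArg₂ (· + ·) (congrArg₂ (· + ·) Finset.sum_comm (by simp)) Finset.sum_comm
  obtain ⟨K, hK⟩ : ∃ K, K = matConv ν hν (funConv R N) := ⟨_, rfl⟩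
  obtain ⟨v, hv⟩ : ∃ v, v = N + K - matConv ρ₀ hρ₀ (N + K) := ⟨_, rfl⟩
  have hAv : v - matConv μ hμ v = N + K := by
    rw [hv, map_sub]
    linear_combination (norm := module) -(hres (N + K))
  have hint : integ v = funConv R N := by
    rw [← sub_eq_zero]
    have hs0 : SuppIn (0 : SignedMeasure ℝ) (Ici 0) := fun _ _ _ => rfl
    refine volterra_unique (ν := fun _ _ => 0) hμ (fun _ _ => hs0) hμ0 ?_
    have h0 : ∀ f, matConv (fun _ _ => (0 : SignedMeasure ℝ)) (fun _ _ => hs0) f =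
        (0 : Fin d → Causal) := by
      intro f
      ext i t
      rw [matConv_apply_apply]
      simp [sInt, SignedMeasure.toJordanDecomposition_zero, JordanDecomposition.zero_posPart,
        JordanDecomposition.zero_negPart]
    have h1 := congrArg integ hAv
    rw [map_sub, map_add, integ_matConv, hK] at h1
    have h2 := hP N
    rw [h0, map_zero, map_sub]
    linear_combination (norm := module) h1 - h2
  have hKv : integ (matConv ν hν v) = K := by rw [integ_matConv, hint, hK]
  have hP2 := hP N₂
  rw [← hK]
  suffices h : z - (v - (fun i => ∑ l, c l • R i l) + funConv R N₂) = 0 by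
    rw [sub_eq_zero] at h
    rw [h, hv]
    abel
  refine volterra_unique hμ hν hμ0 ?_
  simp only [map_sub, map_add, hKv]
  linear_combination (norm := module) hz - hAv + hRc - hP2

lemma sInt_congr_nonneg {s : SignedMeasure ℝ} (hs : SuppIn s (Ici 0)) {f g : ℝ → ℝ}
    (h : ∀ r, 0 ≤ r → f r = g r) : sInt s f = sInt s g :=
  sInt_congr ((hs.ae_mem measurableSet_Ici).mono h)

/-- The truncated time reversal of a causal function. -/
def Causal.reverse (f : Causal) (t : ℝ) : ℝ → ℝ := (Icc 0 t).indicator fun r => f.1 (t - r)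

namespace Causal

lemma measurable_reverse (f : Causal) (t : ℝ) : Measurable (f.reverse t) :=
  (f.measurable.comp (measurable_const.sub measurable_id)).indicator measurableSet_Icc

lemma reverse_bound (f : Causal) (t : ℝ) : ∃ C, ∀ x, |f.reverse t x| ≤ C := by
  obtain ⟨C, hC0, hC⟩ := f.exists_bound t
  refine ⟨C, fun x => ?_⟩
  by_cases hx : x ∈ Icc 0 t
  · rw [reverse, indicator_of_mem hx]
    exact hC _ (by linarith [hx.1])
  · rw [reverse, indicator_of_notMem hx, abs_zero]
    exact hC0

lemma reverse_of_nonneg (f : Causal) {t r : ℝ} (hr : 0 ≤ r) : f.reverse t r = f.1 (t - r) := by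
  by_cases hx : r ∈ Icc 0 t
  · rw [reverse, indicator_of_mem hx]
  · rw [reverse, indicator_of_notMem hx, f.eq_zero]
    by_contra h
    exact hx ⟨hr, by linarith⟩

lemma reverse_of_notMem (f : Causal) {t r : ℝ} (hr : r ∉ Icc 0 t) : f.reverse t r = 0 :=
  indicator_of_notMem hr _

end Causal

lemma mconv_eq_reverse (s : SignedMeasure ℝ) (hs : SuppIn s (Ici 0)) (f : Causal) (t : ℝ) :
    (mconv s hs f).1 t = sInt s (f.reverse t) :=
  sInt_congr_nonneg hs fun _ hr => (f.reverse_of_nonneg hr).symm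

lemma matConv_resolvent {μ ρ₀ : Fin d → Fin d → SignedMeasure ℝ}
    (hμ : ∀ i j, SuppIn (μ i j) (Ici 0)) (hρ₀ : ∀ i j, SuppIn (ρ₀ i j) (Ici 0))
    (h : ∀ i j, ∀ E : Set ℝ, MeasurableSet E →
      ρ₀ i j E - ∑ l, sConv (μ i l) (ρ₀ l j) E = -(μ i j E)) (f : Fin d → Causal) :
    matConv ρ₀ hρ₀ f - matConv μ hμ (matConv ρ₀ hρ₀ f) = -matConv μ hμ f := by
  have key : ∀ i j, mconv (ρ₀ i j) (hρ₀ i j) (f j) -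
      ∑ l, mconv (μ i l) (hμ i l) (mconv (ρ₀ l j) (hρ₀ l j) (f j)) =
        -mconv (μ i j) (hμ i j) (f j) := by
    intro i j
    ext t
    have := ((IsMeasureFunctional.of_signedMeasure (ρ₀ i j)).sub
      (IsMeasureFunctional.finset_sum Finset.univ fun l =>
        (IsMeasureFunctional.of_signedMeasure (μ i l)).comp
          (IsMeasureFunctional.of_signedMeasure (ρ₀ l j)))).eq_of_indicator
      (IsMeasureFunctional.of_signedMeasure (μ i j)).neg MeasurableSet.univ
      (fun E _ hE => by
        rw [sInt_indicator_one _ hE, sInt_indicator_one _ hE, ← h i j E hE]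
        rfl)
      ((f j).measurable_reverse t) ((f j).reverse_bound t) (by simp)
    rw [Causal.coe_sub_apply, Causal.sum_apply, mconv_eq_reverse]
    refine Eq.trans ?_ (this.trans ?_)
    · congr 1
      refine Finset.sum_congr rfl fun l _ => ?_
      rw [mconv_apply]
      refine sInt_congr_nonneg (hμ i l) fun s hs => ?_
      rw [mconv_apply]
      refine sInt_congr_nonneg (hρ₀ l j) fun r hr => ?_
      rw [Causal.reverse_of_nonneg _ (add_nonneg hs hr), sub_sub]
    · rw [← mconv_eq_reverse _ (hμ i j)]
      rfl
  ext1 i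
  rw [Pi.sub_apply, Pi.neg_apply, matConv_apply, matConv_apply, matConv_apply,
    ← Finset.sum_neg_distrib, ← Finset.sum_congr rfl fun j _ => key i j, Finset.sum_sub_distrib]
  congr 1
  simp only [matConv_apply, map_sum]
  exact Finset.sum_comm

lemma sInt_kernel {νp ρ₀ κ₂ : Fin d → Fin d → SignedMeasure ℝ} {ρ : ℝ → Fin d → Fin d → ℝ}
    (hν : ∀ i j, SuppIn (νp i j) (Ici 0)) (hρ₀ : ∀ i j, SuppIn (ρ₀ i j) (Ici 0))
    {R : Fin d → Fin d → Causal} (hR : ∀ i j t, (R i j).1 t = ρ t i j)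
    (hκ₂ : ∀ i j, ∀ E : Set ℝ, MeasurableSet E →
      κ₂ i j E = (∫ t in E ∩ Ioi (0:ℝ), kappa1 νp ρ t i j)
        - ρ₀ i j E - convMeasDens ρ₀ (kappa1 νp ρ) E i j) (f : Fin d → Causal) (i : Fin d) (t : ℝ) :
    ∑ j, sInt (κ₂ i j) ((f j).reverse t) =
      (matConv νp hν (funConv R f) i).1 t -
        (matConv ρ₀ hρ₀ (f + matConv νp hν (funConv R f)) i).1 t := by
  obtain ⟨k, hk⟩ : ∃ k : Fin d → Fin d → Causal,
    k = fun i j => ∑ l, mconv (νp i l) (hν i l) (R l j) := ⟨_, rfl⟩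
  have hk1 : ∀ i j x, (k i j).1 x = kappa1 νp ρ x i j := by
    intro i j x
    rw [hk, Causal.sum_apply]
    simp only [mconv_apply, hR]
    rfl
  rw [matConv_funConv, ← hk]
  have hcut : ∀ (g u : ℝ → ℝ), (∀ x, t < x → u x = 0) →
      ∫ x in Ioi (0 : ℝ), g x * u x = ∫ x in Ioc 0 t, g x * u x := by
    intro g u hu
    refine (setIntegral_eq_of_subset_of_forall_sdiff_eq_zero measurableSet_Ioi Ioc_subset_Ioi_self
      fun x hx => ?_)
    rw [hu x (by
      by_contra h
      exact hx.2 ⟨hx.1, not_lt.1 h⟩), mul_zero]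
  have hdens : ∀ i j, IsMeasureFunctional fun u => ∫ x in Ioc 0 t, (k i j).1 x * u x := fun i j =>
    IsMeasureFunctional.density (k i j).measurable
      (by
        rcases le_total 0 t with ht | ht
        · exact (intervalIntegrable_iff_integrableOn_Ioc_of_le ht).1 ((k i j).intervalIntegrable 0 t)
        · simp [Ioc_eq_empty_of_le ht])
  have hconv : ∀ i j s, 0 ≤ s → ((k i j).conv (f j)).1 (t - s) =
      ∫ x in Ioc 0 t, (k i j).1 x * (f j).reverse t (s + x) := by
    intro i j s hs
    rw [Causal.conv_apply, Causal.integral_eq_setIntegral _ _ (show t - s ≤ t by linarith),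
      integral_Icc_eq_integral_Ioc]
    refine setIntegral_congr_fun measurableSet_Ioc fun x hx => ?_
    rw [Causal.reverse_of_nonneg _ (add_nonneg hs hx.1.le), sub_sub]
  have key : ∀ j, sInt (κ₂ i j) ((f j).reverse t) =
      ((k i j).conv (f j)).1 t - (mconv (ρ₀ i j) (hρ₀ i j) (f j)).1 t -
        ∑ l, (mconv (ρ₀ i l) (hρ₀ i l) ((k l j).conv (f j))).1 t := by
    intro j
    have := (IsMeasureFunctional.of_signedMeasure (κ₂ i j)).eq_of_indicator
      (((hdens i j).sub (IsMeasureFunctional.of_signedMeasure (ρ₀ i j))).sub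
        (IsMeasureFunctional.finset_sum Finset.univ fun l =>
          (IsMeasureFunctional.of_signedMeasure (ρ₀ i l)).comp (hdens l j)))
      (measurableSet_Icc (a := 0) (b := t)) (fun E hEt hE => by
        rw [sInt_indicator_one _ hE, sInt_indicator_one _ hE, hκ₂ i j E hE]
        congr 1
        · congr 1
          rw [← hcut _ _ fun x hx => indicator_of_notMem (fun h => hx.not_ge (hEt h).2) _,
            inter_comm, ← setIntegral_indicator hE]
          refine integral_congr_ae (.of_forall fun x => ?_)
          by_cases hx : x ∈ E <;> simp [hx, hk1]
        · refine Finset.sum_congr rfl fun l _ => sInt_congr_nonneg (hρ₀ i l) fun s hs => ?_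
          rw [← hcut _ _ fun x hx => indicator_of_notMem (fun h => by
            have := (hEt h).2
            linarith) _]
          simp only [hk1])
      ((f j).measurable_reverse t) ((f j).reverse_bound t) fun x hx => (f j).reverse_of_notMem hx
    rw [this, ← mconv_eq_reverse _ (hρ₀ i j)]
    congr 1
    · congr 1
      simpa using (hconv i j 0 le_rfl).symm
    · refine Finset.sum_congr rfl fun l _ => ?_
      rw [mconv_apply]
      exact sInt_congr_nonneg (hρ₀ i l) fun s hs => (hconv l j s hs).symm
  rw [Finset.sum_congr rfl fun j _ => key j]
  simp only [map_add, Pi.add_apply, Causal.coe_add_apply, matConv_apply, funConv_apply, map_sum,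
    Causal.sum_apply, Finset.sum_sub_distrib, Finset.sum_add_distrib]
  rw [Finset.sum_comm (f := fun j l => (mconv (ρ₀ i l) (hρ₀ i l) ((k l j).conv (f j))).1 t)]
  ring

lemma SuppIn.reflect {s r : SignedMeasure ℝ} {τ : ℝ} (hs : SuppIn s (Icc (-τ) 0))
    (h : ∀ E, MeasurableSet E → r E = s (Neg.neg ⁻¹' E)) : SuppIn r (Ici 0) := by
  intro E hE hE0
  rw [h E hE]
  refine hs _ (measurable_neg hE) (eq_empty_of_forall_notMem fun x hx => ?_)
  exact (hE0 ▸ notMem_empty (-x)) ⟨hx.1, neg_nonneg.2 hx.2.2⟩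

lemma sInt_eq_mconv_reflect {s r : SignedMeasure ℝ} {τ : ℝ} (hs : SuppIn s (Icc (-τ) 0))
    (h : ∀ E, MeasurableSet E → r E = s (Neg.neg ⁻¹' E)) (f : Causal) (t : ℝ) :
    (sInt s fun x => f.1 (t + x)) = (mconv r (hs.reflect h) f).1 t := by
  obtain ⟨C, hC⟩ := f.reverse_bound t
  have e : (sInt s fun x => f.1 (t + x)) = sInt s fun x => f.reverse t (-x) := by
    refine sInt_congr ((hs.ae_mem measurableSet_Icc).mono fun x hx => ?_)
    have hx : 0 ≤ -x := neg_nonneg.2 hx.2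
    rw [f.reverse_of_nonneg hx, sub_neg_eq_add]
  rw [e, sInt_neg_preimage (f := fun x => f.reverse t (-x)) h
    ((f.measurable_reverse t).comp measurable_neg) ⟨C, fun x => hC _⟩, mconv_eq_reverse]
  simp only [neg_neg]

lemma mconv_apply_zero {s : SignedMeasure ℝ} (hs : SuppIn s (Ici 0)) (h0 : s {0} = 0)
    (f : Causal) : (mconv s hs f).1 0 = 0 := by
  have hne : ∀ᵐ r ∂s.totalVariation, r ≠ 0 :=
    compl_mem_ae_iff.2 (totalVariation_singleton_eq_zero h0)
  rw [mconv_apply, sInt_congr (g := fun _ => 0)]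
  · simp [sInt]
  · filter_upwards [hs.ae_mem measurableSet_Ici, hne] with r hr hr0
    exact f.eq_zero (by simpa using lt_of_le_of_ne hr hr0.symm)

lemma continuous_mconv {s : SignedMeasure ℝ} (hs : SuppIn s (Ici 0)) {f : Causal}
    (hf : Continuous f.1) : Continuous (mconv s hs f).1 := by
  have h0 : ∀ᵐ r ∂s.totalVariation, 0 ≤ r := hs.ae_mem measurableSet_Ici
  have key : ∀ p : Measure ℝ, IsFiniteMeasure p → (∀ᵐ r ∂p, 0 ≤ r) →
      Continuous fun t => ∫ r, f.1 (t - r) ∂p := by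
    intro p _ hp
    refine continuous_iff_continuousAt.2 fun t₀ => ?_
    obtain ⟨C, -, hC⟩ := f.exists_bound (t₀ + 1)
    refine continuousAt_of_dominated (bound := fun _ => C) (.of_forall fun t =>
      (f.measurable.comp (measurable_const.sub measurable_id)).aestronglyMeasurable) ?_
      (integrable_const C) (.of_forall fun r => by fun_prop)
    filter_upwards [eventually_le_nhds (lt_add_one t₀)] with t ht
    exact hp.mono fun r hr => hC _ (by linarith)
  exact (key _ inferInstance (ae_mono (posPart_le_totalVariation s) h0)).sub
    (key _ inferInstance (ae_mono (negPart_le_totalVariation s) h0))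

namespace Causal

/-- The causal function that agrees on `[0,∞)` with a given continuous function. -/
def ofContinuousOn (f : ℝ → ℝ) (hf : ContinuousOn f (Ici 0)) : Causal :=
  ⟨(Ici 0).indicator f, by
    classical
    rw [← piecewise_eq_indicator]
    exact hf.measurable_piecewise continuousOn_const measurableSet_Ici,
    fun t ht => indicator_of_notMem (notMem_Ici.2 ht) _, fun T => by
      obtain ⟨C, hC⟩ := isCompact_Icc.exists_bound_of_continuousOn
        (hf.mono (Icc_subset_Ici_self : Icc 0 T ⊆ Ici 0))
      refine ⟨max C 0, fun t ht => ?_⟩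
      by_cases h : t ∈ Ici 0
      · rw [indicator_of_mem h]
        exact (hC t ⟨h, ht⟩).trans (le_max_left _ _)
      · rw [indicator_of_notMem h, abs_zero]
        exact le_max_right _ _⟩

variable {f : ℝ → ℝ} (hf : ContinuousOn f (Ici 0))

lemma ofContinuousOn_apply {t : ℝ} (ht : 0 ≤ t) : (ofContinuousOn f hf).1 t = f t :=
  indicator_of_mem (mem_Ici.2 ht) f

lemma coe_ofContinuousOn (h0 : ∀ t < 0, f t = 0) : (ofContinuousOn f hf).1 = f :=
  indicator_eq_self.2 fun t ht => not_lt.1 fun h => ht (h0 t h)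

lemma eq_add_heaviside_conv {F : ℝ → ℝ} {G : Causal} (hF : ContinuousOn F (Ici 0))
    (hd : ∀ t, 0 < t → HasDerivWithinAt F (G.1 t) (Ioi t) t) {t : ℝ} (ht : 0 ≤ t) :
    F t = F 0 + (heaviside.conv G).1 t := by
  rw [heaviside_conv_apply G ht, intervalIntegral.integral_eq_sub_of_hasDeriv_right_of_le ht
    (hF.mono Icc_subset_Ici_self) (fun x hx => hd x hx.1) (G.intervalIntegrable 0 t)]
  ring

end Causal

lemma resolvent_eq {τ : ℝ} {μ ν μp νp : Fin d → Fin d → SignedMeasure ℝ}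
    (hμ : ∀ i j, SuppIn (μ i j) (Icc (-τ) 0)) (hν : ∀ i j, SuppIn (ν i j) (Icc (-τ) 0))
    (hμ0 : ∀ i j, μp i j {0} = 0)
    (hμp : ∀ i j, ∀ E : Set ℝ, MeasurableSet E → μp i j E = μ i j (Neg.neg ⁻¹' E))
    (hνp : ∀ i j, ∀ E : Set ℝ, MeasurableSet E → νp i j E = ν i j (Neg.neg ⁻¹' E))
    {ρ : ℝ → Fin d → Fin d → ℝ} (hρ : IsNeutralResolvent μ ν ρ) {R : Fin d → Fin d → Causal}
    (hR : ∀ i j t, (R i j).1 t = ρ t i j) (i j : Fin d) :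
    R i j = ∑ l, mconv (μp i l) ((hμ i l).reflect (hμp i l)) (R l j) +
      (if i = j then heaviside else 0) +
        heaviside.conv (∑ l, mconv (νp i l) ((hν i l).reflect (hνp i l)) (R l j)) := by
  obtain ⟨-, hρ1, -, hd⟩ := hρ
  refine Causal.ext_nonneg fun t ht => ?_
  simp only [← hR, sInt_eq_mconv_reflect (hμ _ _) (hμp _ _),
    sInt_eq_mconv_reflect (hν _ _) (hνp _ _), ← Causal.sum_apply] at hd
  have h1 := Causal.eq_add_heaviside_conv (fun t ht => (hd t ht i j).continuousWithinAt)
    (fun t ht => (hd t ht.le i j).mono (Ioi_subset_Ici ht.le)) ht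
  have h2 : (∑ l, mconv (μp i l) ((hμ i l).reflect (hμp i l)) (R l j)).1 0 = 0 := by
    rw [Causal.sum_apply]
    exact Finset.sum_eq_zero fun l _ => mconv_apply_zero _ (hμ0 i l) _
  have h3 : (if i = j then heaviside else 0 : Causal).1 t = (R i j).1 0 := by
    rw [hR, hρ1]
    by_cases h : i = j <;> simp [h, heaviside_apply ht]
  rw [Causal.coe_add_apply, Causal.coe_add_apply, h3]
  linarith

lemma neutral_eq {μ ν : Fin d → Fin d → SignedMeasure ℝ}
    (hμ : ∀ i j, SuppIn (μ i j) (Ici 0)) (hν : ∀ i j, SuppIn (ν i j) (Ici 0))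
    {z n₁ n₂ : ℝ → Fin d → ℝ} (hn₁ : ∀ i, ContinuousOn (fun t => n₁ t i) (Ici 0))
    (hn₂ : ∀ i, ContinuousOn (fun t => n₂ t i) (Ici 0)) {Z : Fin d → Causal}
    (hZ : ∀ i t, (Z i).1 t = z t i) (hZc : ∀ i, Continuous (Z i).1)
    (hu0 : ∀ i, z 0 i - (∑ l, sInt (μ i l) fun s => z (0 - s) l) - n₁ 0 i = -n₁ 0 i)
    (hu : ∀ t : ℝ, 0 < t → ∀ i,
      HasDerivAt (fun u => z u i - (∑ l, sInt (μ i l) fun s => z (u - s) l) - n₁ u i)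
        ((∑ l, sInt (ν i l) fun s => z (t - s) l) + n₂ t i) t) :
    Z = matConv μ hμ Z + (fun i => Causal.ofContinuousOn _ (hn₁ i)) -
      (fun i => n₁ 0 i • heaviside) + integ (matConv ν hν Z) +
        integ fun i => Causal.ofContinuousOn _ (hn₂ i) := by
  ext1 i
  refine Causal.ext_nonneg fun t ht => ?_
  simp only [← hZ, ← matConv_apply_apply _ hμ, ← matConv_apply_apply _ hν] at hu hu0
  have hc : Continuous (matConv μ hμ Z i).1 := by
    have : (matConv μ hμ Z i).1 = fun t => ∑ l, (mconv (μ i l) (hμ i l) (Z l)).1 t := by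
      ext t
      rw [matConv_apply, Causal.sum_apply]
    rw [this]
    exact continuous_finsetSum _ fun l _ => continuous_mconv (hμ i l) (hZc l)
  have h1 := Causal.eq_add_heaviside_conv
    (G := matConv ν hν Z i + Causal.ofContinuousOn _ (hn₂ i))
    (((hZc i).sub hc).continuousOn.sub (hn₁ i)) (fun t ht => by
      rw [Causal.coe_add_apply, Causal.ofContinuousOn_apply _ ht.le]
      exact (hu t ht i).hasDerivWithinAt) ht
  simp only [Pi.sub_apply] at h1
  rw [hu0 i, map_add, Causal.coe_add_apply] at h1
  simp only [Pi.add_apply, Pi.sub_apply, integ_apply, Causal.coe_add_apply, Causal.coe_sub_apply,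
    Causal.coe_smul_apply, Causal.ofContinuousOn_apply _ ht, heaviside_apply ht]
  linarith

lemma funConv_ofContinuousOn_apply {R : Fin d → Fin d → Causal} {n : ℝ → Fin d → ℝ}
    (hn : ∀ i, ContinuousOn (fun t => n t i) (Ici 0)) (i : Fin d) {t : ℝ} (ht : 0 ≤ t) :
    (funConv R (fun i => Causal.ofContinuousOn _ (hn i)) i).1 t =
      ∫ s in (0 : ℝ)..t, ∑ l, (R i l).1 (t - s) * n s l := by
  rw [funConv_apply, Causal.sum_apply, intervalIntegral.integral_of_le ht]
  have h : ∀ s ∈ Ioc 0 t, ∑ l, (R i l).1 (t - s) * n s l =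
      ∑ l, (Causal.ofContinuousOn _ (hn l)).1 s * (R i l).1 (t - s) := fun s hs =>
    Finset.sum_congr rfl fun l _ => by rw [Causal.ofContinuousOn_apply _ hs.1.le, mul_comm]
  rw [setIntegral_congr_fun measurableSet_Ioc h, integral_finsetSum _ fun l _ =>
    (Causal.integrable_mul_shift _ _ t).integrableOn]
  refine Finset.sum_congr rfl fun l _ => ?_
  rw [Causal.conv_comm, Causal.conv_apply, Causal.integral_eq_setIntegral _ _ le_rfl,
    integral_Icc_eq_integral_Ioc]

/-- deterministic representation formula. If `u(t) = z(t) −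
∫_{[0,t]} μ₊(ds) z(t−s) − n₁(t)` is differentiable with `u'(t) = ∫_{[0,t]} ν₊(ds) z(t−s)
+ n₂(t)` and `u(0) = −n₁(0)`, then
`z(t) = n₁(t) − ρ(t)n₁(0) + ∫₀ᵗ ρ(t−s) n₂(s) ds + ∫_{[0,t]} κ₂(ds) n₁(t−s)`, where
`κ₂ = κ₁ dt − ρ₀ − ρ₀∗(κ₁ dt)` and `κ₁ = ν₊∗ρ`. -/
theorem stmt18
    (d : ℕ) (τ : ℝ) (hτ : 0 ≤ τ)
    (μ ν μp νp : Fin d → Fin d → SignedMeasure ℝ)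
    (hμsupp : ∀ i j, SuppIn (μ i j) (Icc (-τ) 0))
    (hνsupp : ∀ i j, SuppIn (ν i j) (Icc (-τ) 0))
    (hμ0 : ∀ i j, μ i j {0} = 0)
    (hμp : ∀ i j, ∀ E : Set ℝ, MeasurableSet E → μp i j E = μ i j (Neg.neg ⁻¹' E))
    (hνp : ∀ i j, ∀ E : Set ℝ, MeasurableSet E → νp i j E = ν i j (Neg.neg ⁻¹' E))
    (hPW : PW μ) (hv0 : v0Neg μ ν)
    (ρ : ℝ → Fin d → Fin d → ℝ) (hρ : IsNeutralResolvent μ ν ρ)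
    (hρL1 : ∀ i j, Integrable (fun t => ρ t i j) (volume.restrict (Ioi 0)))
    -- ρ₀ is the (finite) integral resolvent of −μ₊ : ρ₀ − μ₊∗ρ₀ = −μ₊
    (ρ₀ : Fin d → Fin d → SignedMeasure ℝ)
    (hρ₀supp : ∀ i j, SuppIn (ρ₀ i j) (Ici 0))
    (hρ₀ : ∀ i j, ∀ E : Set ℝ, MeasurableSet E →
      ρ₀ i j E - ∑ l, sConv (μp i l) (ρ₀ l j) E = -(μp i j E))
    -- κ₂ = κ₁ dt − ρ₀ − ρ₀∗(κ₁ dt), a finite matrix measure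
    (κ₂ : Fin d → Fin d → SignedMeasure ℝ)
    (hκ₂ : ∀ i j, ∀ E : Set ℝ, MeasurableSet E →
      κ₂ i j E = (∫ t in E ∩ Ioi (0:ℝ), kappa1 νp ρ t i j)
        - ρ₀ i j E - convMeasDens ρ₀ (kappa1 νp ρ) E i j)
    -- the data z, n₁, n₂
    (z : ℝ → Fin d → ℝ)
    (hzcont : ∀ i, Continuous fun t => z t i)
    (hzinit : ∀ t : ℝ, t ≤ 0 → z t = 0)
    (n₁ n₂ : ℝ → Fin d → ℝ)
    (hn₁ : ∀ i, ContinuousOn (fun t => n₁ t i) (Ici 0))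
    (hn₂ : ∀ i, ContinuousOn (fun t => n₂ t i) (Ici 0))
    -- u(t) = z(t) − ∫_{[0,t]} μ₊(ds) z(t−s) − n₁(t) satisfies u(0) = −n₁(0) and
    -- u'(t) = ∫_{[0,t]} ν₊(ds) z(t−s) + n₂(t) on (0,∞)
    (hu0 : ∀ i, z 0 i - (∑ l, sInt (μp i l) fun s => z (0 - s) l) - n₁ 0 i = -n₁ 0 i)
    (hu : ∀ t : ℝ, 0 < t → ∀ i,
      HasDerivAt
        (fun u => z u i - (∑ l, sInt (μp i l) fun s => z (u - s) l) - n₁ u i)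
        ((∑ l, sInt (νp i l) fun s => z (t - s) l) + n₂ t i) t) :
    ∀ t : ℝ, 0 ≤ t → ∀ i,
      z t i = n₁ t i - (∑ l, ρ t i l * n₁ 0 l)
        + (∫ s in (0:ℝ)..t, ∑ l, ρ (t - s) i l * n₂ s l)
        + ∑ l, sInt (κ₂ i l) ((Icc (0:ℝ) t).indicator fun s => n₁ (t - s) l) := by
  intro t ht i
  have hμp0 : ∀ i j, μp i j {0} = 0 := fun i j => by
    have h : Neg.neg ⁻¹' {(0 : ℝ)} = {0} := by
      ext x
      simp
    rw [hμp i j _ (measurableSet_singleton 0), h, hμ0]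
  have hμs : ∀ i j, SuppIn (μp i j) (Ici 0) := fun i j => (hμsupp i j).reflect (hμp i j)
  have hνs : ∀ i j, SuppIn (νp i j) (Ici 0) := fun i j => (hνsupp i j).reflect (hνp i j)
  obtain ⟨R, hR⟩ : ∃ R : Fin d → Fin d → Causal, ∀ i j t, (R i j).1 t = ρ t i j :=
    ⟨fun i j => Causal.ofContinuousOn _ (hρ.2.2.1 i j), fun i j t => congrFun
      (Causal.coe_ofContinuousOn (hρ.2.2.1 i j) fun t ht => by rw [hρ.1 t ht]; rfl) t⟩
  obtain ⟨Z, hZ⟩ : ∃ Z : Fin d → Causal, ∀ i t, (Z i).1 t = z t i :=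
    ⟨fun i => Causal.ofContinuousOn _ (hzcont i).continuousOn, fun i t => congrFun
      (Causal.coe_ofContinuousOn (hzcont i).continuousOn
        fun t ht => by rw [hzinit t ht.le]; rfl) t⟩
  have key := congrArg (fun f : Fin d → Causal => (f i).1 t) (causal_representation hμs hνs hρ₀supp
    hμp0 (resolvent_eq hμsupp hνsupp hμp0 hμp hνp hρ hR) (matConv_resolvent hμs hρ₀supp hρ₀)
    (neutral_eq hμs hνs hn₁ hn₂ hZ (fun i => by
      rw [show (Z i).1 = fun t => z t i from funext (hZ i)]
      exact hzcont i) hu0 hu))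
  have hκ : ∀ l, (Icc (0:ℝ) t).indicator (fun s => n₁ (t - s) l) =
      (Causal.ofContinuousOn _ (hn₁ l)).reverse t := fun l =>
    indicator_congr fun s hs => (Causal.ofContinuousOn_apply (hn₁ l) (sub_nonneg.2 hs.2)).symm
  simp only [hκ]
  rw [sInt_kernel hνs hρ₀supp hR hκ₂ (fun l => Causal.ofContinuousOn _ (hn₁ l))]
  simp only [Pi.add_apply, Pi.sub_apply, Causal.coe_add_apply, Causal.coe_sub_apply,
    Causal.sum_apply, Causal.coe_smul_apply, Causal.ofContinuousOn_apply _ ht, hZ, hR,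
    funConv_ofContinuousOn_apply hn₂ i ht] at key
  rw [key]
  simp only [mul_comm (n₁ 0 _)]
  ring

end
end
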